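/- arXiv:math/0203273 — 6 statements merged into one kernel-verified Lean document; each statement's English description precedes it below -/
import Mathlib

section
/- Let K be a field, L a field extension of K, V a finite-dimensional L-vector space, and A a K-subalgebra of the K-algebra End_L(V) of L-linear endomorphisms of V such that for every a ∈ A the characteristic polynomial of a acting on V has all its coefficients in the image of K in L. Let R be the Jacobson radical of A and n = dim_L V. If K is infinite, then A/R is a semisimple ring and there is a ring isomorphism of A/R with a product S₁ × ⋯ × S_k of simple rings with k ≤ n. If moreover K is infinite and perfect, then A/R is finite-dimensional over K and for every field extension L′ of K the ring L′ ⊗[K] (A/R) is semisimple (i.e. A/R is a separable K-algebra). -/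
open TensorProduct

universe u v

/-- A subset `S` of a (possibly noncommutative) ring is *nilpotent* if there is an `n ≥ 1`
such that every product of `n` elements of `S` vanishes. -/
def IsNilpotentSet {R : Type*} [Ring R] (S : Set R) : Prop :=
  ∃ n : ℕ, 0 < n ∧ ∀ l : List R, (∀ x ∈ l, x ∈ S) → l.length = n → l.prod = 0

/-- A `K`-algebra `B` is *separable* (or absolutely semisimple) if `L ⊗[K] B` is a
semisimple ring for every field extension `L/K`. -/
def IsSeparableKAlgebra (K : Type u) [Field K] (B : Type v) [Ring B] [Algebra K B] : Prop :=
  ∀ (L : Type u) [Field L] [Algebra K L], IsSemisimpleRing (TensorProduct K L B)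

/-- The relation on a ring identifying two elements whose difference lies in the Jacobson
radical (the intersection of the maximal left ideals). -/
def jacRel (A : Type*) [Ring A] : A → A → Prop :=
  fun a b => a - b ∈ Ideal.jacobson (⊥ : Ideal A)

/-- The quotient of a ring by its Jacobson radical (which is a two-sided ideal), realized
as a `RingQuot`. -/
abbrev JacQuot (A : Type*) [Ring A] := RingQuot (jacRel A)

theorem exists_isIdempotentElem_mem_of_jacobson_eq_bot (K : Type*) {B : Type*} [Field K] [Ring B]
    [Algebra K B] [Algebra.IsIntegral K B] (hJ : Ring.jacobson B = ⊥) {I : Ideal B}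
    (hI : I ≠ ⊥) : ∃ e ∈ I, IsIdempotentElem e ∧ e ≠ 0 := by
  obtain ⟨x, hxI, hx0⟩ := Submodule.exists_mem_ne_zero_of_ne_bot hI
  have hxJ : x ∉ Ring.jacobson B := by simpa [hJ] using hx0
  simp only [Ring.jacobson_eq_sInf_isMaximal, Submodule.mem_sInf, not_forall] at hxJ
  obtain ⟨M, hM, hxM⟩ := hxJ
  obtain ⟨b, m, hmM, hbm⟩ : ∃ b, ∃ m ∈ M, b * x + m = 1 := hM.exists_inv hxM
  set y := b * x with hy
  have hyI : y ∈ I := I.mul_mem_left b hxI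
  have hyn : ¬ IsNilpotent y := fun h ↦ by
    have hu : IsUnit m := by
      rw [show m = 1 - y by rw [← hbm]; abel]
      exact h.isUnit_one_sub
    exact hM.ne_top (Ideal.eq_top_of_isUnit_mem _ hmM hu)
  obtain ⟨p, hp, hpy⟩ := Algebra.IsIntegral.isIntegral (R := K) y
  rw [← Polynomial.aeval_def] at hpy
  obtain ⟨g, hpg, hg⟩ := Polynomial.exists_eq_pow_rootMultiplicity_mul_and_not_dvd p hp.ne_zero 0
  set k := p.rootMultiplicity 0
  rw [map_zero, sub_zero] at hpg hg
  obtain ⟨u, v, huv⟩ : IsCoprime (Polynomial.X ^ (k + 1) : Polynomial K) g :=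
    ((Polynomial.irreducible_X.coprime_iff_not_dvd).mpr hg).pow_left
  have hpy' : y ^ k * Polynomial.aeval y g = 0 := by simpa [hpg] using hpy
  have huv' : Polynomial.aeval y u * y ^ (k + 1) +
      Polynomial.aeval y v * Polynomial.aeval y g = 1 := by
    simpa using congr(Polynomial.aeval y $huv)
  have hc : Commute (y ^ (k + 1)) (Polynomial.aeval y v) := by
    simpa [Commute, SemiconjBy] using
      congr(Polynomial.aeval y $(mul_comm (Polynomial.X ^ (k + 1)) v))
  have hpy2 : y ^ (k + 1) * Polynomial.aeval y g = 0 := by rw [pow_succ', mul_assoc, hpy', mul_zero]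
  have key : y ^ (k + 1) * (Polynomial.aeval y u * y ^ (k + 1)) = y ^ (k + 1) := by
    have := congr(y ^ (k + 1) * $huv')
    rwa [mul_add, ← mul_assoc _ (Polynomial.aeval y v), hc.eq, mul_assoc (Polynomial.aeval y v),
      hpy2, mul_zero, add_zero, mul_one] at this
  refine ⟨Polynomial.aeval y u * y ^ (k + 1), I.mul_mem_left _ ?_, ?_, fun h ↦ hyn ⟨k + 1, ?_⟩⟩
  · rw [pow_succ]
    exact I.mul_mem_left _ hyI
  · rw [IsIdempotentElem, mul_assoc, key]
  · rw [← key, h, mul_zero]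

theorem OrthogonalIdempotents.card_le_natDegree {K B ι : Type*} [Field K] [Infinite K] [Ring B]
    [Algebra K B] [Fintype ι] {n : ℕ}
    (hB : ∀ b : B, ∃ p : Polynomial K, p.Monic ∧ p.natDegree ≤ n ∧ Polynomial.aeval b p = 0)
    {e : ι → B} (he : OrthogonalIdempotents e) (he0 : ∀ i, e i ≠ 0) : Fintype.card ι ≤ n := by
  classical
  let c : ι ↪ K := (Fintype.equivFin ι).toEmbedding.trans <|
    Fin.valEmbedding.trans (Infinite.natEmbedding K)
  obtain ⟨p, hp, hpn, hpb⟩ := hB (∑ j, c j • e j)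
  set b := ∑ j, c j • e j with hb
  have hbe (i : ι) : b * e i = c i • e i := by
    simp [hb, Finset.sum_mul, he.mul_eq]
  have hroot (i : ι) : p.eval (c i) = 0 := by
    have hq (q : Polynomial K) : Polynomial.aeval b q * e i = q.eval (c i) • e i := by
      induction q using Polynomial.induction_on' with
      | add p q hp hq => simp [add_mul, add_smul, hp, hq]
      | monomial m a =>
        have : b ^ m * e i = c i ^ m • e i := by
          induction m with
          | zero => simp
          | succ m ih => rw [pow_succ, mul_assoc, hbe, mul_smul_comm, ih, smul_smul, pow_succ']
        rw [Polynomial.aeval_monomial, mul_assoc, this, Polynomial.eval_monomial,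
          ← Algebra.smul_def, smul_smul]
    have := hq p
    rw [hpb, zero_mul] at this
    exact (smul_eq_zero.mp this.symm).resolve_right (he0 i)
  calc Fintype.card ι = (Finset.univ.map c).card := by simp
    _ ≤ p.roots.toFinset.card := Finset.card_le_card fun x hx ↦ by
        obtain ⟨i, -, rfl⟩ := Finset.mem_map.mp hx
        simpa [hp.ne_zero] using hroot i
    _ ≤ p.natDegree := (Multiset.toFinset_card_le _).trans p.card_roots'
    _ ≤ n := hpn

theorem isSemisimpleRing_of_orthogonalIdempotents_bounded {B : Type*} [Ring B] {n : ℕ}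
    (hbdd : ∀ (m : ℕ) (e : Fin m → B), OrthogonalIdempotents e → (∀ i, e i ≠ 0) → m ≤ n)
    (hidem : ∀ I : Ideal B, I ≠ ⊥ → ∃ e ∈ I, IsIdempotentElem e ∧ e ≠ 0) :
    IsSemisimpleRing B := by
  classical
  suffices h : ∀ I : Ideal B, ∃ e ∈ I, IsIdempotentElem e ∧ ∀ x ∈ I, x * e = x by
    refine { exists_isCompl := fun I ↦ ?_ }
    obtain ⟨e, heI, he, hx⟩ := h I
    refine ⟨Ideal.span {1 - e}, ?_, ?_⟩
    · rw [Submodule.disjoint_def]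
      intro x hxI hxs
      obtain ⟨b, rfl⟩ := Ideal.mem_span_singleton'.mp hxs
      rw [← hx _ hxI, mul_assoc, sub_mul, one_mul, he.eq, sub_self, mul_zero]
    · rw [codisjoint_iff, Ideal.eq_top_iff_one]
      have := Submodule.add_mem_sup heI (Ideal.mem_span_singleton_self (1 - e))
      rwa [add_sub_cancel] at this
  intro I
  let P : ℕ → Prop := fun m ↦
    ∃ e : Fin m → B, OrthogonalIdempotents e ∧ (∀ i, e i ≠ 0) ∧ ∀ i, e i ∈ I
  have hP0 : P 0 := ⟨Fin.elim0, ⟨fun i ↦ i.elim0, fun i ↦ i.elim0⟩, fun i ↦ i.elim0,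
    fun i ↦ i.elim0⟩
  obtain ⟨e, he, he0, heI⟩ : P (Nat.findGreatest P n) := Nat.findGreatest_spec (Nat.zero_le n) hP0
  have hmax : ¬ P (Nat.findGreatest P n + 1) := fun hP ↦ by
    obtain ⟨e, he, he0, heI⟩ := id hP
    have := Nat.le_findGreatest (hbdd _ e he he0) hP
    omega
  generalize Nat.findGreatest P n = m at *
  set s := ∑ i, e i with hs
  have hsI : s ∈ I := I.sum_mem fun i _ ↦ heI i
  have hss : s * s = s := (he.isIdempotentElem_sum (s := Finset.univ)).eq
  refine ⟨s, hsI, hss, fun x hxI ↦ ?_⟩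
  by_contra hxs
  let N : Ideal B := I ⊓ LinearMap.ker (LinearMap.toSpanSingleton B B s)
  have hN : N ≠ ⊥ := fun h ↦ by
    have : x * s - x ∈ N := ⟨I.sub_mem (I.mul_mem_left _ hsI) hxI, by
      simp [sub_mul, mul_assoc, hss]⟩
    rw [h, Submodule.mem_bot, sub_eq_zero] at this
    exact hxs this
  obtain ⟨f, ⟨hfI, hfs⟩, hff, hf0⟩ := hidem N hN
  replace hfs : f * s = 0 := by simpa using hfs
  have hff : f * f = f := hff
  have hf' : f * ((1 - s) * f) = f := by rw [sub_mul, one_mul, mul_sub, ← mul_assoc, hfs]; simp [hff]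
  have hopt := he.option ((1 - s) * f) (by rw [IsIdempotentElem, mul_assoc, hf'])
    (by rw [mul_assoc, hfs, mul_zero]) (by rw [← mul_assoc, mul_sub, ← hs, hss]; simp)
  refine hmax ⟨_, hopt.embedding (finSuccEquiv m).toEmbedding, fun i ↦ ?_, fun i ↦ ?_⟩
  · rcases h : finSuccEquiv m i with _ | j
    · simp only [Function.comp_apply, Equiv.coe_toEmbedding, h, Option.elim]
      exact fun h0 ↦ hf0 (by rw [← hf', h0, mul_zero])
    · simpa [h] using he0 j
  · rcases h : finSuccEquiv m i with _ | j
    · simpa [h] using I.mul_mem_left _ hfI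
    · simpa [h] using heI j

theorem Algebra.finite_adjoin_singleton_and_finrank_le {K B : Type*} [Field K] [Ring B]
    [Algebra K B] {n : ℕ} {b : B} {p : Polynomial K} (hp : p.Monic) (hpn : p.natDegree ≤ n)
    (hpb : Polynomial.aeval b p = 0) :
    Module.Finite K (Algebra.adjoin K {b}) ∧ Module.finrank K (Algebra.adjoin K {b}) ≤ n := by
  have h : Subalgebra.toSubmodule (Algebra.adjoin K {b}) =
      (Polynomial.degreeLT K n).map (Polynomial.aeval b).toLinearMap := by
    ext x
    simp only [Subalgebra.mem_toSubmodule, Algebra.adjoin_singleton_eq_range_aeval,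
      AlgHom.mem_range, Submodule.mem_map, AlgHom.toLinearMap_apply]
    refine ⟨fun ⟨q, hq⟩ ↦ ⟨q %ₘ p, ?_, ?_⟩, fun ⟨q, _, hq⟩ ↦ ⟨q, hq⟩⟩
    · rw [Polynomial.mem_degreeLT]
      exact (Polynomial.degree_modByMonic_lt q hp).trans_le
        (Polynomial.degree_le_natDegree.trans (by exact_mod_cast hpn))
    · rw [← hq]
      conv_rhs => rw [← Polynomial.modByMonic_add_div q p]
      simp [hpb]
  have : Module.Finite K (Polynomial.degreeLT K n) :=
    .equiv (Polynomial.degreeLTEquiv K n).symm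
  have hfr : Module.finrank K (Polynomial.degreeLT K n) = n := by
    rw [(Polynomial.degreeLTEquiv K n).finrank_eq, Module.finrank_fin_fun]
  change Module.Finite K (Subalgebra.toSubmodule (Algebra.adjoin K {b})) ∧
    Module.finrank K (Subalgebra.toSubmodule (Algebra.adjoin K {b})) ≤ n
  rw [h]
  exact ⟨inferInstance, (Submodule.finrank_map_le _ _).trans hfr.le⟩

theorem exists_adjoin_singleton_eq_top (K S : Type*) [Field K] [PerfectField K] [CommRing S]
    [IsDomain S] [Algebra K S] [FiniteDimensional K S] :
    ∃ γ : S, Algebra.adjoin K {γ} = ⊤ := by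
  let : Field S := (isField_of_isIntegral_of_isField' (Field.toIsField K)).toField
  obtain ⟨γ, hγ⟩ := Field.exists_primitive_element K S
  refine ⟨γ, ?_⟩
  rw [← IntermediateField.adjoin_simple_toSubalgebra_of_isAlgebraic
    (Algebra.IsAlgebraic.isAlgebraic γ), hγ, IntermediateField.top_toSubalgebra]

theorem isReduced_tensorProduct_of_perfectField (K L Z : Type*) [Field K] [PerfectField K]
    [Field L] [Algebra K L] [CommRing Z] [IsDomain Z] [Algebra K Z] [FiniteDimensional K Z] :
    IsReduced (L ⊗[K] Z) := by
  let : Field Z := (isField_of_isIntegral_of_isField' (Field.toIsField K)).toField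
  have : Algebra.FormallyUnramified K Z :=
    (Algebra.FormallyUnramified.iff_isSeparable K Z).mpr inferInstance
  exact Algebra.FormallyUnramified.isReduced_of_field L (L ⊗[K] Z)

open scoped IsMulCommutative in
theorem Algebra.exists_adjoin_pair_eq_adjoin_singleton {K D : Type*} [Field K] [PerfectField K]
    [DivisionRing D] [Algebra K D] [Algebra.IsIntegral K D] {x y : D} (hxy : Commute x y) :
    ∃ γ : D, Algebra.adjoin K {x, y} = Algebra.adjoin K {γ} := by
  have : IsMulCommutative (Algebra.adjoin K {x, y}) := by
    apply Algebra.isMulCommutative_adjoin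
    rintro a (rfl | rfl) b (rfl | rfl)
    exacts [rfl, hxy.eq, hxy.eq.symm, rfl]
  have : Algebra.IsIntegral K (Algebra.adjoin K {x, y}) :=
    .of_injective (Algebra.adjoin K {x, y}).val Subtype.val_injective
  have : Algebra.FiniteType K (Algebra.adjoin K {x, y}) := by
    rw [← Subalgebra.fg_iff_finiteType]
    classical
    exact ⟨{x, y}, by simp⟩
  have : Module.Finite K (Algebra.adjoin K {x, y}) :=
    Algebra.IsIntegral.finite (R := K) (A := Algebra.adjoin K {x, y})
  obtain ⟨γ, hγ⟩ := exists_adjoin_singleton_eq_top K (Algebra.adjoin K {x, y})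
  refine ⟨γ, ?_⟩
  have := congr(Subalgebra.map (Algebra.adjoin K {x, y}).val $hγ)
  rw [AlgHom.map_adjoin_singleton, Algebra.map_top, Subalgebra.range_val] at this
  exact this.symm

theorem DivisionRing.exists_finite_adjoin_and_centralizer_le {K D : Type*} [Field K]
    [PerfectField K] [DivisionRing D] [Algebra K D] {n : ℕ}
    (hD : ∀ b : D, ∃ p : Polynomial K, p.Monic ∧ p.natDegree ≤ n ∧ Polynomial.aeval b p = 0) :
    ∃ F : Subalgebra K D, Module.Finite K F ∧ ∀ c : D, (∀ x ∈ F, c * x = x * c) → c ∈ F := by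
  have : Algebra.IsIntegral K D := ⟨fun b ↦ by
    obtain ⟨p, hp, -, hb⟩ := hD b
    exact ⟨p, hp, hb⟩⟩
  have hfin (b : D) : Module.Finite K (Algebra.adjoin K {b}) ∧
      Module.finrank K (Algebra.adjoin K {b}) ≤ n := by
    obtain ⟨p, hp, hpn, hb⟩ := hD b
    exact Algebra.finite_adjoin_singleton_and_finrank_le hp hpn hb
  obtain ⟨θ, hθ⟩ : ∃ θ : D, ∀ γ : D, Module.finrank K (Algebra.adjoin K {γ}) ≤
      Module.finrank K (Algebra.adjoin K {θ}) := by
    have hfinite : (Set.range fun γ : D ↦ Module.finrank K (Algebra.adjoin K {γ})).Finite :=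
      (Set.finite_Iic n).subset (by rintro _ ⟨γ, rfl⟩; exact (hfin γ).2)
    obtain ⟨_, ⟨⟨θ, rfl⟩, hθ⟩⟩ := hfinite.exists_maximal (Set.range_nonempty _)
    exact ⟨θ, fun γ ↦ (le_total _ _).elim id fun h ↦ hθ ⟨γ, rfl⟩ h⟩
  refine ⟨Algebra.adjoin K {θ}, (hfin θ).1, fun c hc ↦ ?_⟩
  obtain ⟨γ, hγ⟩ := Algebra.exists_adjoin_pair_eq_adjoin_singleton (K := K)
    (show Commute θ c from (hc θ (Algebra.self_mem_adjoin_singleton K θ)).symm)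
  have hle : Algebra.adjoin K {θ} ≤ Algebra.adjoin K {γ} :=
    hγ ▸ Algebra.adjoin_mono (by simp)
  have := (hfin γ).1
  rw [Subalgebra.eq_of_le_of_finrank_le hle (hθ γ), ← hγ]
  exact Algebra.subset_adjoin (by simp)

theorem DivisionRing.finite_of_centralizer_le {K D : Type*} [Field K] [DivisionRing D]
    [Algebra K D] (F : Subalgebra K D) [Module.Finite K F]
    (hF : ∀ c : D, (∀ x ∈ F, c * x = x * c) → c ∈ F) : Module.Finite K D := by
  let f : D → (F →ₗ[K] D) := fun x ↦ (LinearMap.mulRight K x).comp F.val.toLinearMap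
  have hf (x : D) (y : F) : f x y = y * x := rfl
  obtain ⟨κ, a, -, hspan, hli⟩ := exists_linearIndependent' D f
  have : Module.Finite D (F →ₗ[K] D) :=
    .equiv ((Module.finBasis K F).constr D)
  have := hli.finite
  have := Fintype.ofFinite κ
  refine .of_surjective (∑ i, (LinearMap.mulRight K (a i)).comp
    (F.val.toLinearMap.comp (LinearMap.proj i)) : (κ → F) →ₗ[K] D) fun y ↦ ?_
  have hy : f y ∈ Submodule.span D (Set.range (f ∘ a)) :=
    hspan ▸ Submodule.subset_span ⟨y, rfl⟩
  obtain ⟨c, hc⟩ := (Submodule.mem_span_range_iff_exists_fun D).mp hy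
  have hc' (e : F) : ∑ i, c i * (e * a i) = e * y := by
    simpa [hf] using congr($hc e)
  have hcF (i : κ) : c i ∈ F := by
    refine hF _ fun x hx ↦ ?_
    have h0 : ∑ i, (c i * x - x * c i) • (f ∘ a) i = 0 := by
      ext e
      have h1 := hc' (⟨x, hx⟩ * e)
      have h2 := congr(x * $(hc' e))
      simp only [Finset.mul_sum, MulMemClass.coe_mul, mul_assoc] at h1 h2
      simp [hf, sub_mul, mul_assoc, h1, h2]
    exact sub_eq_zero.mp (Fintype.linearIndependent_iff.mp hli _ h0 i)
  refine ⟨fun i ↦ ⟨c i, hcF i⟩, ?_⟩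
  simpa using hc' 1

theorem DivisionRing.eq_bot_of_forall_isNilpotent_tensorProduct {K D : Type*} [Field K]
    [PerfectField K] [DivisionRing D] [Algebra K D] [FiniteDimensional K D] (L : Type*) [Field L]
    [Algebra K L] (J : Ideal (L ⊗[K] D)) [J.IsTwoSided] (hJ : ∀ x ∈ J, IsNilpotent x) :
    J = ⊥ := by
  classical
  let Z := Subalgebra.center K D
  have hred : IsReduced (L ⊗[K] Z) := isReduced_tensorProduct_of_perfectField K L Z
  let ℬ := Module.Basis.ofVectorSpace K L
  let φ := TensorProduct.equivFinsuppOfBasisLeft (N := D) ℬ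
  have hφl (d : D) (x : L ⊗[K] D) (i) : φ ((1 ⊗ₜ d) * x) i = d * φ x i := by
    induction x with
    | zero => simp
    | tmul l y => simp [φ]
    | add x y hx hy => simp [mul_add, hx, hy]
  have hφr (d : D) (x : L ⊗[K] D) (i) : φ (x * (1 ⊗ₜ d)) i = φ x i * d := by
    induction x with
    | zero => simp
    | tmul l y => simp [φ]
    | add x y hx hy => simp [add_mul, hx, hy]
  let ψ : L ⊗[K] Z →ₐ[K] L ⊗[K] D := Algebra.TensorProduct.map (AlgHom.id K L) Z.val
  have hψ : Function.Injective ψ :=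
    Module.Flat.lTensor_preserves_injective_linearMap Z.val.toLinearMap Subtype.val_injective
  suffices h : ∀ (m : ℕ) (x : L ⊗[K] D), x ∈ J → (φ x).support.card = m → x = 0 from
    (Submodule.eq_bot_iff J).mpr fun x hx ↦ h _ x hx rfl
  intro m
  induction m using Nat.strong_induction_on with
  | _ m ih =>
  intro x hx hm
  by_contra hx0
  obtain ⟨i₀, hi₀⟩ : ∃ i, φ x i ≠ 0 := by
    by_contra! h
    exact hx0 (φ.injective (by ext i; simp [h]))
  set x' := (1 ⊗ₜ (φ x i₀)⁻¹) * x with hx'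
  have hx'J : x' ∈ J := J.mul_mem_left _ hx
  have hcoord (i) : φ x' i = (φ x i₀)⁻¹ * φ x i := hφl _ _ _
  have hcomm (d : D) : (1 ⊗ₜ d) * x' - x' * (1 ⊗ₜ d) = 0 := by
    refine ih _ ?_ _ (J.sub_mem (J.mul_mem_left _ hx'J) (J.mul_mem_right _ hx'J)) rfl
    rw [← hm]
    refine Finset.card_lt_card (Finset.ssubset_iff_of_subset (fun i hi ↦ ?_) |>.mpr
      ⟨i₀, by simpa using hi₀, ?_⟩)
    · rw [Finsupp.mem_support_iff] at hi ⊢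
      contrapose! hi
      rw [map_sub, Finsupp.sub_apply, hφl, hφr, hcoord, hi]
      simp
    · rw [Finsupp.notMem_support_iff, map_sub, Finsupp.sub_apply, hφl, hφr, hcoord,
        inv_mul_cancel₀ hi₀]
      simp
  have hcen (i) : φ x' i ∈ Z := Subalgebra.mem_center_iff.mpr fun d ↦ by
    have := congr(φ $(hcomm d) i)
    rwa [map_sub, Finsupp.sub_apply, hφl, hφr, map_zero, Finsupp.zero_apply, sub_eq_zero] at this
  have hrange : ψ (∑ i ∈ (φ x').support, ℬ i ⊗ₜ ⟨φ x' i, hcen i⟩) = x' := by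
    apply φ.symm_apply_apply x' |>.symm.trans _ |>.symm
    rw [TensorProduct.equivFinsuppOfBasisLeft_symm_apply, map_sum]
    rfl
  have hnil := hJ x' hx'J
  rw [← hrange, IsNilpotent.map_iff hψ] at hnil
  rw [hnil.eq_zero, map_zero] at hrange
  have := hcoord i₀
  rw [← hrange, inv_mul_cancel₀ hi₀] at this
  simp at this

theorem DivisionRing.isSemisimpleRing_tensorProduct {K D : Type*} [Field K]
    [PerfectField K] [DivisionRing D] [Algebra K D] [FiniteDimensional K D] (L : Type*) [Field L]
    [Algebra K L] : IsSemisimpleRing (L ⊗[K] D) := by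
  have : IsArtinianRing (L ⊗[K] D) := .of_finite L _
  rw [IsArtinianRing.isSemisimpleRing_iff_jacobson]
  obtain ⟨k, hk⟩ := IsSemiprimaryRing.isNilpotent (R := L ⊗[K] D)
  refine DivisionRing.eq_bot_of_forall_isNilpotent_tensorProduct L _ fun x hx ↦ ⟨k, ?_⟩
  have := Ideal.pow_mem_pow hx k
  rwa [hk] at this

theorem IsSemisimpleRing.tensorProduct_matrix {K L D : Type*} [CommRing K] [CommRing L] [Ring D]
    [Algebra K L] [Algebra K D] [IsSemisimpleRing (L ⊗[K] D)] (m : Type*) [Fintype m]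
    [DecidableEq m] : IsSemisimpleRing (L ⊗[K] Matrix m m D) :=
  let e : L ⊗[K] Matrix m m D ≃ₐ[K] Matrix m m (L ⊗[K] D) :=
    (Algebra.TensorProduct.congr AlgEquiv.refl (matrixEquivTensor m K D)).trans <|
      (Algebra.TensorProduct.assoc K K K L D (Matrix m m K)).symm.trans
        (matrixEquivTensor m K (L ⊗[K] D)).symm
  e.symm.toRingEquiv.isSemisimpleRing

theorem jacobson_jacQuot_eq_bot (A : Type*) [Ring A] : Ring.jacobson (JacQuot A) = ⊥ := by
  let f : JacQuot A →+* A ⧸ Ring.jacobson A := RingQuot.lift ⟨Ideal.Quotient.mk _, fun x y h ↦ by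
    rw [jacRel, Ideal.jacobson_bot] at h
    exact Ideal.Quotient.eq.mpr h⟩
  have hf (a : A) : f (RingQuot.mkRingHom _ a) = Ideal.Quotient.mk _ a :=
    RingQuot.lift_mkRingHom_apply _ _ a
  have : RingHomSurjective f := ⟨fun y ↦ by
    obtain ⟨a, rfl⟩ := Ideal.Quotient.mk_surjective y
    exact ⟨_, hf a⟩⟩
  rw [eq_bot_iff]
  intro x hx
  have hfx : f x ∈ Ring.jacobson (A ⧸ Ring.jacobson A) := Ring.le_comap_jacobson f hx
  rw [Ring.jacobson_quotient_jacobson, Submodule.mem_bot] at hfx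
  obtain ⟨a, rfl⟩ := RingQuot.mkRingHom_surjective _ x
  rw [hf, Ideal.Quotient.eq_zero_iff_mem] at hfx
  rw [Submodule.mem_bot, ← map_zero (RingQuot.mkRingHom (jacRel A))]
  exact RingQuot.mkRingHom_rel (by rwa [jacRel, Ideal.jacobson_bot, sub_zero])

theorem exists_monic_aeval_eq_zero_of_charpoly_coeff_mem_range {K L V : Type*} [Field K] [Field L]
    [Algebra K L] [AddCommGroup V] [Module L V] [FiniteDimensional L V] [Module K V]
    [IsScalarTower K L V] (a : Module.End L V)
    (ha : ∀ i : ℕ, (LinearMap.charpoly a).coeff i ∈ Set.range (algebraMap K L)) :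
    ∃ p : Polynomial K, p.Monic ∧ p.natDegree ≤ Module.finrank L V ∧ Polynomial.aeval a p = 0 := by
  obtain ⟨p, hp, hpd, hpm⟩ := Polynomial.lifts_and_natDegree_eq_and_monic
    ((Polynomial.lifts_iff_coeff_lifts _).mpr ha) a.charpoly_monic
  refine ⟨p, hpm, by rw [hpd, LinearMap.charpoly_natDegree], ?_⟩
  rw [← Polynomial.aeval_map_algebraMap L, hp, LinearMap.aeval_self_charpoly]

/-- Let `V` be a finite-dimensional `L`-vector space and `A` a `K`-subalgebra of
`End_L(V)` whose elements have characteristic polynomials with coefficients in (the image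
of) `K`. If `K` is infinite then `A` modulo its Jacobson radical is semisimple, isomorphic
to a product of at most `n = dim_L V` simple rings; if moreover `K` is perfect then
`A` modulo its Jacobson radical is a finite-dimensional separable `K`-algebra. -/
theorem charpoly_in_base_semisimple_quotient
    (K : Type u) [Field K] [Infinite K] (L : Type u) [Field L] [Algebra K L]
    (V : Type u) [AddCommGroup V] [Module L V] [FiniteDimensional L V]
    [Module K V] [IsScalarTower K L V]
    (A : Subalgebra K (Module.End L V))
    (hA : ∀ a : A, ∀ i : ℕ,
      (LinearMap.charpoly (A.val a)).coeff i ∈ Set.range (algebraMap K L)) :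
    IsSemisimpleRing (JacQuot A) ∧
    (∃ k : ℕ, k ≤ Module.finrank L V ∧
      ∃ (S : Fin k → Type u) (_ : ∀ i, Ring (S i)),
        (∀ i, IsSimpleRing (S i)) ∧ Nonempty (JacQuot A ≃+* ((i : Fin k) → S i))) ∧
    (PerfectField K →
      FiniteDimensional K (JacQuot A) ∧ IsSeparableKAlgebra K (JacQuot A)) := by
  classical
  have hB (b : JacQuot A) : ∃ p : Polynomial K, p.Monic ∧
      p.natDegree ≤ Module.finrank L V ∧ Polynomial.aeval b p = 0 := by
    obtain ⟨a, rfl⟩ := RingQuot.mkAlgHom_surjective K (jacRel A) b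
    obtain ⟨p, hp, hpn, hpa⟩ :=
      exists_monic_aeval_eq_zero_of_charpoly_coeff_mem_range (A.val a) (hA a)
    refine ⟨p, hp, hpn, ?_⟩
    rw [Polynomial.aeval_algHom_apply] at hpa ⊢
    rw [(map_eq_zero_iff A.val Subtype.val_injective).mp hpa, map_zero]
  have : Algebra.IsIntegral K (JacQuot A) := ⟨fun b ↦ by
    obtain ⟨p, hp, -, hb⟩ := hB b
    exact ⟨p, hp, hb⟩⟩
  have hss : IsSemisimpleRing (JacQuot A) :=
    isSemisimpleRing_of_orthogonalIdempotents_bounded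
      (fun m e he he0 ↦ by simpa using he.card_le_natDegree hB he0)
      fun I hI ↦ exists_isIdempotentElem_mem_of_jacobson_eq_bot K (jacobson_jacQuot_eq_bot A) hI
  obtain ⟨k, D, d, _, _, hd, ⟨φ⟩⟩ :=
    IsSemisimpleRing.exists_algEquiv_pi_matrix_divisionRing K (JacQuot A)
  refine ⟨hss, ⟨k, ?_, fun i ↦ Matrix (Fin (d i)) (Fin (d i)) (D i), inferInstance,
    fun i ↦ inferInstance, ⟨φ.toRingEquiv⟩⟩, fun _ ↦ ?_⟩
  · have he := (CompleteOrthogonalIdempotents.single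
      fun i ↦ Matrix (Fin (d i)) (Fin (d i)) (D i)).toOrthogonalIdempotents.map
      φ.symm.toRingEquiv.toRingHom
    simpa using he.card_le_natDegree hB fun i h ↦ by simp at h
  have hD (i : Fin k) (x : D i) : ∃ p : Polynomial K, p.Monic ∧
      p.natDegree ≤ Module.finrank L V ∧ Polynomial.aeval x p = 0 := by
    let ι : D i → ∀ j, Matrix (Fin (d j)) (Fin (d j)) (D j) := fun x ↦
      Pi.single i (Matrix.scalar _ x)
    obtain ⟨p, hp, hpn, hpx⟩ := hB (φ.symm (ι x))
    refine ⟨p, hp, hpn, ?_⟩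
    rw [Polynomial.aeval_algHom_apply, map_eq_zero_iff _ φ.symm.injective] at hpx
    let π := Pi.evalAlgHom K (fun j ↦ Matrix (Fin (d j)) (Fin (d j)) (D j)) i
    have h1 : Polynomial.aeval (Matrix.scalarAlgHom (Fin (d i)) K x) p = 0 := by
      have := congr(π $hpx)
      rw [← Polynomial.aeval_algHom_apply, map_zero] at this
      simpa [π, ι] using this
    rw [Polynomial.aeval_algHom_apply] at h1
    simpa using congr_fun (congr_fun h1 0) 0
  have hfin (i : Fin k) : Module.Finite K (D i) := by
    obtain ⟨F, _, hF⟩ := DivisionRing.exists_finite_adjoin_and_centralizer_le (hD i)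
    exact DivisionRing.finite_of_centralizer_le F hF
  refine ⟨.equiv φ.symm.toLinearEquiv, fun L' _ _ ↦ ?_⟩
  have (i : Fin k) : IsSemisimpleRing (L' ⊗[K] Matrix (Fin (d i)) (Fin (d i)) (D i)) :=
    have := DivisionRing.isSemisimpleRing_tensorProduct (K := K) (D := D i) L'
    .tensorProduct_matrix _
  exact ((Algebra.TensorProduct.congr AlgEquiv.refl φ).trans
    (Algebra.TensorProduct.piRight K K L' _)).symm.toRingEquiv.isSemisimpleRing
end

section
/- Let K be an infinite perfect field, L a field extension of K, V a finite-dimensional L-vector space, and A a K-subalgebra of End_L(V) such that for every a ∈ A the characteristic polynomial of a acting on V has all its coefficients in the image of K in L. Let R be the Jacobson radical of A, let AL be the L-subalgebra of End_L(V) generated by A, and let RL be the L-subspace of AL spanned by R. Then: (a) the Jacobson radical of AL equals RL; (b) RL ∩ A = R (an element of A lies in R if and only if it lies in RL); (c) the canonical L-algebra homomorphism (A/R) ⊗[K] L → AL/RL is bijective. -/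
open TensorProduct

universe u

set_option synthInstance.maxHeartbeats 400000
set_option maxHeartbeats 1000000

namespace Matrix
open Polynomial

variable {n R S : Type*} [Fintype n] [DecidableEq n] [CommRing R] [CommRing S]

lemma charpolyRev_map (M : Matrix n n R) (f : R →+* S) :
    (M.map f).charpolyRev = M.charpolyRev.map f := by
  rw [charpolyRev, charpolyRev, ← coe_mapRingHom, RingHom.map_det]
  congr 1
  ext1 i j
  by_cases h : i = j <;> simp [h]

lemma charpolyRev_smul (r : R) (M : Matrix n n R) :
    (r • M).charpolyRev = M.charpolyRev.comp (C r * X) := by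
  rw [charpolyRev, charpolyRev, ← coe_compRingHom_apply, RingHom.map_det]
  congr 1
  ext1 i j
  by_cases h : i = j <;> simp [h] <;> ring

lemma charpolyRev_mul_charpolyRev (x y : Matrix n n R) :
    x.charpolyRev * y.charpolyRev =
      (x.map C + y.map C - (X : R[X]) • (x * y).map C).charpolyRev.eval X := by
  have h : (1 - (X : R[X]) • x.map C) * (1 - (X : R[X]) • y.map C) =
      1 - (X : R[X]) • (x.map C + y.map C - (X : R[X]) • (x * y).map C) := by
    rw [Matrix.map_mul]
    simp only [sub_mul, mul_sub, one_mul, mul_one, smul_mul_assoc, mul_smul_comm, smul_add,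
      smul_sub]
    abel
  rw [charpolyRev, charpolyRev, charpolyRev, ← det_mul, h, ← coe_evalRingHom, RingHom.map_det]
  congr 1
  ext1 i j
  by_cases h : i = j <;> simp [h]

lemma coeff_charpolyRev_zero (M : Matrix n n R) : M.charpolyRev.coeff 0 = 1 := by
  rw [coeff_zero_eq_eval_zero, eval_charpolyRev]

end Matrix

namespace Polynomial
variable {R : Type*} [CommRing R]

lemma exists_eq_one_add_X_pow_mul {p : R[X]} {j : ℕ} (hj : j ≠ 0) (h0 : p.coeff 0 = 1)
    (h : ∀ i, i ≠ 0 → i < j → p.coeff i = 0) :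
    ∃ q : R[X], p = 1 + X ^ j * q ∧ q.coeff 0 = p.coeff j := by
  obtain ⟨q, hq⟩ : X ^ j ∣ p - 1 := by
    refine X_pow_dvd_iff.2 fun d hd => ?_
    rcases eq_or_ne d 0 with rfl | hd0
    · simp [h0]
    · simp [coeff_one, hd0, h d hd0 hd]
  refine ⟨q, by rw [← hq]; ring, ?_⟩
  have := congrArg (fun f => coeff f j) hq
  simpa [coeff_one, hj, coeff_X_pow_mul'] using this.symm

end Polynomial

namespace Matrix
open Polynomial
variable {n R : Type*} [Fintype n] [DecidableEq n] [CommRing R] [IsDomain R]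

/-- The first nonvanishing coefficient of the reverse characteristic polynomial is additive. -/
lemma coeff_charpolyRev_add {s : Set R} (hs : s.Infinite) {j : ℕ} (hj : j ≠ 0) {x y : Matrix n n R}
    (hx : ∀ i, i ≠ 0 → i < j → x.charpolyRev.coeff i = 0)
    (hy : ∀ i, i ≠ 0 → i < j → y.charpolyRev.coeff i = 0)
    (hxy : ∀ c ∈ s, ∀ i, i ≠ 0 → i < j → (x + y - c • (x * y)).charpolyRev.coeff i = 0) :
    (x + y).charpolyRev.coeff j = x.charpolyRev.coeff j + y.charpolyRev.coeff j := by
  set N : Matrix n n R[X] := x.map C + y.map C - (X : R[X]) • (x * y).map C with hN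
  have hmap (c : R) : N.map (evalRingHom c) = x + y - c • (x * y) := by
    ext1 i k
    simp [hN, -Matrix.map_mul, mul_comm c]
  have hcoeff (c : R) (i : ℕ) :
      (N.charpolyRev.coeff i).eval c = (x + y - c • (x * y)).charpolyRev.coeff i := by
    rw [← hmap, charpolyRev_map, coeff_map, coe_evalRingHom]
  obtain ⟨p, hp, hp0⟩ := exists_eq_one_add_X_pow_mul hj (coeff_charpolyRev_zero x) hx
  obtain ⟨q, hq, hq0⟩ := exists_eq_one_add_X_pow_mul hj (coeff_charpolyRev_zero y) hy
  obtain ⟨r, hr, hr0⟩ := exists_eq_one_add_X_pow_mul hj (coeff_charpolyRev_zero N)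
    fun i hi hij => eq_zero_of_infinite_isRoot _ <| hs.mono fun c hc => by
      rw [Set.mem_ofPred_eq, IsRoot, hcoeff, hxy c hc i hi hij]
  have h := charpolyRev_mul_charpolyRev x y
  rw [← hN, hp, hq, hr] at h
  have h' : p + q + X ^ j * (p * q) = r.eval X := by
    refine mul_left_cancel₀ (pow_ne_zero j X_ne_zero : (X : R[X]) ^ j ≠ 0) ?_
    simp only [eval_add, eval_one, eval_mul, eval_pow, eval_X] at h
    linear_combination h
  have h0 := congrArg (eval 0) h'
  have hr' : (r.eval X).eval 0 = (x + y).charpolyRev.coeff j := by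
    have : (r.eval X).eval 0 = (r.coeff 0).eval 0 := by
      rw [← divX_mul_X_add r]; simp
    rw [this, hr0, hcoeff, zero_smul, sub_zero]
  rw [← hr', ← h0, ← hp0, ← hq0, coeff_zero_eq_eval_zero, coeff_zero_eq_eval_zero]
  simp [hj]

lemma coeff_charpolyRev_eq_zero_of_isNilpotent {M : Matrix n n R} (hM : IsNilpotent M) {j : ℕ}
    (hj : j ≠ 0) : M.charpolyRev.coeff j = 0 :=
  ((isUnit_iff_coeff_isUnit_isNilpotent.mp (isUnit_charpolyRev_of_isNilpotent hM)).2 j hj).eq_zero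

lemma isNilpotent_of_coeff_charpolyRev {M : Matrix n n R}
    (hM : ∀ j, j ≠ 0 → M.charpolyRev.coeff j = 0) : IsNilpotent M := by
  refine ⟨Fintype.card n, ?_⟩
  have h : M.charpoly = X ^ Fintype.card n := by
    have h1 : M.charpolyRev = 1 := by
      ext j
      rcases eq_or_ne j 0 with rfl | hj
      · simp [coeff_charpolyRev_zero]
      · simp [hM j hj, coeff_one, hj]
    rw [← reverse_charpoly, reverse, charpoly_natDegree_eq_dim] at h1
    rw [← reflect_reflect (N := Fintype.card n) (p := M.charpoly), h1]
    simp
  simpa [h] using aeval_self_charpoly M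

/-- If a coefficient of the reverse characteristic polynomial is a diagonal form of degree `j` on the
combinations of `w` with scalars in an infinite set, then so it is for all scalars. -/
lemma coeff_charpolyRev_sum_eq {s : Set R} (hs : s.Infinite) {ι : Type*} (t : Finset ι)
    (w : ι → Matrix n n R) (j : ℕ) (a : ι → R)
    (h : ∀ c : ι → R, (∀ i, c i ∈ s) →
      (∑ i ∈ t, c i • w i).charpolyRev.coeff j = ∑ i ∈ t, c i ^ j * a i) (c : ι → R) :
    (∑ i ∈ t, c i • w i).charpolyRev.coeff j = ∑ i ∈ t, c i ^ j * a i := by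
  set N : Matrix n n (MvPolynomial ι R) :=
    ∑ i ∈ t, (MvPolynomial.X i : MvPolynomial ι R) • (w i).map MvPolynomial.C with hN
  have hcoeff (c : ι → R) : MvPolynomial.eval c (N.charpolyRev.coeff j) =
      (∑ i ∈ t, c i • w i).charpolyRev.coeff j := by
    rw [← coeff_map, ← charpolyRev_map]
    congr 2
    ext1 k l
    simp [hN, Matrix.sum_apply]
  have key : N.charpolyRev.coeff j =
      ∑ i ∈ t, MvPolynomial.X i ^ j * MvPolynomial.C (a i) := by
    refine MvPolynomial.funext_set (fun _ => s) (fun _ => hs) fun c hc => ?_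
    rw [hcoeff, h c fun i => hc i trivial]
    simp
  rw [← hcoeff, key]
  simp
end Matrix

lemma exists_eq_expChar_pow {K : Type*} [Field K] [Infinite K] (p : ℕ) [ExpChar K p] (j : ℕ)
    (hj : j ≠ 0) (h : ∀ c d : K, (c + d) ^ j = c ^ j + d ^ j) : ∃ k, j = p ^ k := by
  induction j using Nat.strong_induction_on with
  | _ j ih =>
  rcases eq_or_ne j 1 with rfl | hj1
  · exact ⟨0, by simp⟩
  have hjK : (j : K) = 0 := by
    have hp : (Polynomial.X + 1 : Polynomial K) ^ j = Polynomial.X ^ j + 1 :=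
      Polynomial.funext fun c => by simp [h]
    have := congrArg (fun f => (Polynomial.derivative f).eval 0) hp
    simpa [Polynomial.derivative_pow, hj1, Nat.sub_eq_zero_iff_le, show ¬ j ≤ 1 by lia] using this
  cases ‹ExpChar K p› with
  | zero => simp [hj] at hjK
  | prime hp =>
    obtain ⟨i, rfl⟩ := (CharP.cast_eq_zero_iff K p j).1 hjK
    have : Fact p.Prime := ⟨hp⟩
    have hi : i ≠ 0 := by rintro rfl; simp at hj
    obtain ⟨k, rfl⟩ := ih i (by nlinarith [hp.two_le, Nat.pos_of_ne_zero hi]) hi fun c d => by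
      refine frobenius_inj K p ?_
      simp only [frobenius_def, add_pow_char, ← pow_mul, mul_comm i p, h]
    exact ⟨k + 1, by ring⟩

lemma LinearIndependent.eq_zero_of_sum_pow_expChar {K L ι : Type*} [Field K] [PerfectField K]
    [Field L] [Algebra K L] (p : ℕ) [ExpChar K p] {v : ι → L} (hv : LinearIndependent K v)
    (k : ℕ) (t : Finset ι) (a : ι → K)
    (h : ∑ i ∈ t, v i ^ p ^ k * algebraMap K L (a i) = 0) {i : ι} (hi : i ∈ t) : a i = 0 := by
  have : ExpChar L p := expChar_of_injective_algebraMap (algebraMap K L).injective p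
  choose b hb using fun i => (bijective_iterateFrobenius (R := K) (p := p) (n := k)).2 (a i)
  have hs : ∑ i ∈ t, b i • v i = 0 := by
    refine (iterateFrobenius L p k).injective ?_
    rw [map_sum, map_zero, ← h]
    refine Finset.sum_congr rfl fun i _ => ?_
    rw [← hb i, iterateFrobenius_def, iterateFrobenius_def, Algebra.smul_def, mul_pow, map_pow,
      mul_comm]
  rw [← hb i, linearIndependent_iff'.1 hv t b hs i hi, map_zero]

/-- Let `I` be a multiplicatively closed `K`-space of matrices over `L` whose characteristic
polynomials have coefficients in `K`. If `I` is spanned by the coordinates, with respect to a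
`K`-linearly independent family of scalars, of nilpotent matrices, then `I` is nil. -/
theorem Matrix.isNilpotent_of_mem_of_coords {K L n ι : Type*} [Field K] [Infinite K]
    [PerfectField K] [Field L] [Algebra K L] [Fintype n] [DecidableEq n]
    (I : Submodule K (Matrix n n L)) (hmul : ∀ x ∈ I, ∀ y ∈ I, x * y ∈ I)
    (hK : ∀ x ∈ I, ∀ j, x.charpolyRev.coeff j ∈ Set.range (algebraMap K L))
    {v : ι → L} (hv : LinearIndependent K v) (G : Set (Matrix n n L))
    (hIG : I = Submodule.span K G)
    (hG : ∀ g ∈ G, ∃ w : ι →₀ Matrix n n L, (∀ i, w i ∈ I) ∧ (∃ i, w i = g) ∧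
      IsNilpotent (w.sum fun i m => v i • m)) :
    ∀ x ∈ I, IsNilpotent x := by
  have hs : (Set.range (algebraMap K L)).Infinite :=
    Set.infinite_range_of_injective (algebraMap K L).injective
  suffices H : ∀ j, j ≠ 0 → ∀ x ∈ I, x.charpolyRev.coeff j = 0 from
    fun x hx => isNilpotent_of_coeff_charpolyRev fun j hj => H j hj x hx
  intro j
  induction j using Nat.strong_induction_on with
  | _ j ih =>
  intro hj
  have hadd : ∀ x ∈ I, ∀ y ∈ I, (x + y).charpolyRev.coeff j =
      x.charpolyRev.coeff j + y.charpolyRev.coeff j := by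
    intro x hx y hy
    refine coeff_charpolyRev_add hs hj (fun i hi hij => ih i hij hi x hx)
      (fun i hi hij => ih i hij hi y hy) ?_
    rintro _ ⟨c, rfl⟩ i hi hij
    rw [algebraMap_smul]
    exact ih i hij hi _ (I.sub_mem (I.add_mem hx hy) (I.smul_mem c (hmul x hx y hy)))
  have hsmul (c : K) (x : Matrix n n L) : (c • x).charpolyRev.coeff j =
      algebraMap K L c ^ j * x.charpolyRev.coeff j := by
    rw [← algebraMap_smul L c x, charpolyRev_smul, Polynomial.comp_C_mul_X_coeff, mul_comm]
  by_contra! ⟨x, hx, hx0⟩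
  obtain ⟨p, _⟩ := ExpChar.exists K
  obtain ⟨k, rfl⟩ : ∃ k, j = p ^ k := exists_eq_expChar_pow p j hj fun c d => by
    have h := hadd _ (I.smul_mem c hx) _ (I.smul_mem d hx)
    rw [← add_smul, hsmul, hsmul, hsmul, ← add_mul] at h
    exact (algebraMap K L).injective (by simpa using mul_right_cancel₀ hx0 h)
  have hsum (t : Finset ι) (w : ι → Matrix n n L) (hw : ∀ i, w i ∈ I) (c : ι → K) :
      (∑ i ∈ t, c i • w i).charpolyRev.coeff (p ^ k) =
        ∑ i ∈ t, algebraMap K L (c i) ^ p ^ k * (w i).charpolyRev.coeff (p ^ k) := by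
    classical
    induction t using Finset.induction_on with
    | empty =>
      simpa using coeff_charpolyRev_eq_zero_of_isNilpotent (M := (0 : Matrix n n L)) .zero hj
    | insert i t hi iht =>
      rw [Finset.sum_insert hi, Finset.sum_insert hi, hadd _ (I.smul_mem _ (hw i)) _
        (I.sum_mem fun i _ => I.smul_mem _ (hw i)), iht, hsmul]
  have hG0 : ∀ g ∈ G, g.charpolyRev.coeff (p ^ k) = 0 := by
    rintro g hg
    obtain ⟨w, hwI, ⟨i, rfl⟩, hw⟩ := hG g hg
    choose a ha using fun i => hK (w i) (hwI i) (p ^ k)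
    have h := coeff_charpolyRev_sum_eq hs w.support w (p ^ k)
      (fun i => (w i).charpolyRev.coeff (p ^ k)) (fun c hc => by
        choose c' hc' using hc
        obtain rfl : c = fun i => algebraMap K L (c' i) := funext fun i => (hc' i).symm
        simpa only [algebraMap_smul] using hsum w.support w hwI c') v
    rw [← Finsupp.sum, coeff_charpolyRev_eq_zero_of_isNilpotent hw hj] at h
    by_cases hi : i ∈ w.support
    · have := hv.eq_zero_of_sum_pow_expChar p k w.support a (by simpa only [ha] using h.symm) hi
      rw [← ha, this, map_zero]
    · rw [Finsupp.notMem_support_iff.1 hi]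
      exact coeff_charpolyRev_eq_zero_of_isNilpotent .zero hj
  refine hx0 ?_
  clear hx0
  rw [hIG] at hx
  induction hx using Submodule.span_induction with
  | mem g hg => exact hG0 g hg
  | zero => exact coeff_charpolyRev_eq_zero_of_isNilpotent .zero hj
  | add y z hy hz ihy ihz => rw [hadd y (hIG ▸ hy) z (hIG ▸ hz), ihy, ihz, add_zero]
  | smul c y hy ihy => rw [hsmul, ihy, mul_zero]

lemma IsIntegral.isNilpotent_of_mem_jacobson {F B : Type*} [Field F] [Ring B] [Algebra F B]
    {x : B} (hx : IsIntegral F x) (hj : x ∈ Ideal.jacobson (⊥ : Ideal B)) : IsNilpotent x := by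
  obtain ⟨g, hg, hg0⟩ := Polynomial.exists_eq_pow_rootMultiplicity_mul_and_not_dvd
    (minpoly F x) (minpoly.ne_zero hx) 0
  rw [map_zero, sub_zero] at hg hg0
  set k := Polynomial.rootMultiplicity 0 (minpoly F x)
  rw [Polynomial.X_dvd_iff] at hg0
  obtain ⟨z, hz⟩ := Ideal.mem_jacobson_iff.1 hj
    (Polynomial.aeval x (Polynomial.C (g.coeff 0)⁻¹ * g.divX))
  have hz' : z * Polynomial.aeval x (Polynomial.C (g.coeff 0)⁻¹ * g) = 1 := by
    rw [Ideal.mem_bot, sub_eq_zero] at hz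
    nth_rw 2 [← Polynomial.divX_mul_X_add g]
    rw [← hz, mul_add, ← map_mul, inv_mul_cancel₀ hg0, ← mul_assoc]
    simp [mul_add, mul_assoc]
  refine ⟨k, ?_⟩
  have h0 : Polynomial.aeval x (Polynomial.C (g.coeff 0)⁻¹ * g) * x ^ k = 0 := by
    have := minpoly.aeval F x
    rw [hg, mul_comm, map_mul, map_pow, Polynomial.aeval_X] at this
    rw [map_mul, mul_assoc, this, mul_zero]
  rw [← one_mul (x ^ k), ← hz', mul_assoc, h0, mul_zero]

lemma Ideal.mem_jacobson_bot_of_isNilpotent_mul {B : Type*} [Ring B] {x : B}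
    (h : ∀ y, IsNilpotent (y * x)) : x ∈ Ideal.jacobson (⊥ : Ideal B) := by
  refine Ideal.mem_jacobson_iff.2 fun y => ?_
  obtain ⟨u, hu⟩ := (h y).isUnit_add_one
  refine ⟨↑u⁻¹, ?_⟩
  rw [Ideal.mem_bot, sub_eq_zero, mul_assoc]
  nth_rw 2 [← mul_one (↑u⁻¹ : B)]
  rw [← mul_add, ← hu, Units.inv_mul]

lemma Submodule.exists_finsupp_of_mem_span {K L E ι : Type*} [Field K] [Field L] [Algebra K L]
    [AddCommGroup E] [Module K E] [Module L E] [IsScalarTower K L E] (v : Module.Basis ι K L)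
    (P : Submodule K E) {f : E} (hf : f ∈ Submodule.span L (P : Set E)) :
    ∃ w : ι →₀ E, (∀ i, w i ∈ P) ∧ w.sum (fun i m => v i • m) = f := by
  induction hf using Submodule.closure_induction with
  | zero => exact ⟨0, fun _ => P.zero_mem, by simp⟩
  | add x y _ _ hx hy =>
    obtain ⟨w, hw, rfl⟩ := hx
    obtain ⟨w', hw', rfl⟩ := hy
    exact ⟨w + w', fun i => P.add_mem (hw i) (hw' i),
      Finsupp.sum_add_index' (by simp) (by simp)⟩
  | smul_mem c x hx =>
    refine ⟨(v.repr c).mapRange (fun k => k • x) (zero_smul K x), fun i => P.smul_mem _ hx, ?_⟩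
    rw [Finsupp.sum_mapRange_index (by simp)]
    nth_rw 2 [← v.linearCombination_repr c]
    rw [Finsupp.linearCombination_apply, Finsupp.sum, Finsupp.sum, Finset.sum_smul]
    exact Finset.sum_congr rfl fun i _ => by rw [smul_assoc, smul_comm]

lemma Module.End.coeff_charpolyRev_mem_range {K L V : Type*} [Field K] [Field L] [Algebra K L]
    [AddCommGroup V] [Module L V] [FiniteDimensional L V] {f : Module.End L V}
    (hf : ∀ i, f.charpoly.coeff i ∈ Set.range (algebraMap K L)) (j : ℕ) :
    (LinearMap.toMatrixAlgEquiv (Module.finBasis L V) f).charpolyRev.coeff j ∈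
      Set.range (algebraMap K L) := by
  rw [← Matrix.reverse_charpoly, Polynomial.coeff_reverse]
  have h : (LinearMap.toMatrixAlgEquiv (Module.finBasis L V) f).charpoly = f.charpoly :=
    LinearMap.charpoly_toMatrix f _
  rw [h]
  exact hf _

section

variable {K L V : Type*} [Field K] [Infinite K] [Field L] [Algebra K L] [AddCommGroup V]
  [Module L V] [FiniteDimensional L V] [Module K V] [IsScalarTower K L V]

/-- The `L`-span of a nil `K`-space of endomorphisms is nil. -/
lemma Module.End.isNilpotent_of_mem_span (P : Submodule K (Module.End L V))
    (hP : ∀ f ∈ P, IsNilpotent f) {f : Module.End L V}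
    (hf : f ∈ Submodule.span L (P : Set (Module.End L V))) : IsNilpotent f := by
  obtain ⟨w, hwP, rfl⟩ := Submodule.exists_finsupp_of_mem_span (Module.Basis.ofVectorSpace K L) P hf
  set v := Module.Basis.ofVectorSpace K L
  set ψ := LinearMap.toMatrixAlgEquiv (Module.finBasis L V)
  rw [← IsNilpotent.map_iff ψ.injective]
  refine Matrix.isNilpotent_of_coeff_charpolyRev fun j hj => ?_
  have h := Matrix.coeff_charpolyRev_sum_eq
    (Set.infinite_range_of_injective (algebraMap K L).injective) w.support (fun i => ψ (w i)) j
    (fun _ => 0) (fun c hc => by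
      choose c' hc' using hc
      obtain rfl : c = fun i => algebraMap K L (c' i) := funext fun i => (hc' i).symm
      have hsum : ∑ i ∈ w.support, algebraMap K L (c' i) • ψ (w i) =
          ψ (∑ i ∈ w.support, c' i • w i) := by
        rw [map_sum]
        exact Finset.sum_congr rfl fun i _ => by rw [← algebraMap_smul L (c' i) (w i), map_smul]
      rw [hsum, Matrix.coeff_charpolyRev_eq_zero_of_isNilpotent
        ((hP _ (P.sum_mem fun i _ => P.smul_mem _ (hwP i))).map ψ) hj]
      simp) v
  rw [Finsupp.sum, map_sum]
  simpa using h

variable [PerfectField K] {ι : Type*}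

/-- If an `L`-linear combination of elements of `A`, with `K`-linearly independent coefficients,
lies in a nil left `A`-module, then its components lie in the Jacobson radical of `A`. -/
lemma Subalgebra.mem_jacobson_of_sum_smul_mem (A : Subalgebra K (Module.End L V))
    (hA : ∀ a : A, ∀ i : ℕ,
      (LinearMap.charpoly (A.val a)).coeff i ∈ Set.range (algebraMap K L))
    {v : ι → L} (hv : LinearIndependent K v) (N : Set (Module.End L V))
    (hleft : ∀ a ∈ A, ∀ f ∈ N, a * f ∈ N)
    (hN : ∀ f ∈ N, IsNilpotent f) {w : ι →₀ A}
    (hw : w.sum (fun i a => v i • (a : Module.End L V)) ∈ N) (i : ι) :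
    w i ∈ Ideal.jacobson (⊥ : Ideal A) := by
  set W : Set (ι →₀ A) := {w | w.sum (fun i a => v i • (a : Module.End L V)) ∈ N} with hW
  set G : Set A := {a | ∃ w ∈ W, ∃ i, w i = a} with hG
  set I : Submodule K A := Submodule.span K G with hI
  have hWl (a : A) (w) (h : w ∈ W) : w.mapRange (a * ·) (mul_zero a) ∈ W := by
    have := hleft a a.2 _ h
    simp only [hW, Set.mem_ofPred_eq]
    rw [Finsupp.sum_mapRange_index (by simp)]
    simpa [Finsupp.sum, Finset.mul_sum] using this
  have hIl (a x : A) (hx : x ∈ I) : a * x ∈ I := by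
    induction hx using Submodule.span_induction with
    | mem x hx =>
      obtain ⟨w, hw, i, rfl⟩ := hx
      exact Submodule.subset_span ⟨_, hWl a w hw, i, by simp⟩
    | zero => simp
    | add x y _ _ hx hy => rw [mul_add]; exact I.add_mem hx hy
    | smul c x _ hx => rw [mul_smul_comm]; exact I.smul_mem c hx
  set ψ := LinearMap.toMatrixAlgEquiv (Module.finBasis L V)
  set φ : A →ₐ[K] Matrix _ _ L := (ψ.toAlgHom.restrictScalars K).comp A.val with hφ
  have hφinj : Function.Injective φ := ψ.injective.comp Subtype.val_injective
  have hnil : ∀ x ∈ I.map φ.toLinearMap, IsNilpotent x := by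
    refine Matrix.isNilpotent_of_mem_of_coords (I.map φ.toLinearMap) ?_ ?_ hv (φ '' G) ?_ ?_
    · rintro _ ⟨x, hx, rfl⟩ _ ⟨y, hy, rfl⟩
      exact ⟨x * y, hIl x y hy, map_mul φ x y⟩
    · rintro _ ⟨x, -, rfl⟩ j
      exact Module.End.coeff_charpolyRev_mem_range (hA x) j
    · rw [hI, Submodule.map_span]; rfl
    · rintro _ ⟨_, ⟨w, hw, i, rfl⟩, rfl⟩
      refine ⟨w.mapRange φ (map_zero φ), fun i => ⟨w i, Submodule.subset_span ⟨w, hw, i, rfl⟩, ?_⟩,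
        ⟨i, ?_⟩, ?_⟩
      · simp
      · simp
      · rw [Finsupp.sum_mapRange_index (by simp)]
        have := (hN _ hw).map ψ
        simpa [Finsupp.sum, hφ] using this
  refine Ideal.mem_jacobson_bot_of_isNilpotent_mul fun y => ?_
  rw [← IsNilpotent.map_iff hφinj]
  exact hnil _ ⟨_, hIl y _ (Submodule.subset_span ⟨w, hw, i, rfl⟩), rfl⟩

end

/-- Let `K` be an infinite perfect field, `V` a finite-dimensional `L`-vector space and
`A` a `K`-subalgebra of `End_L(V)` whose elements have characteristic polynomials with
coefficients in (the image of) `K`. Let `R` be the Jacobson radical of `A`, `AL` the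
`L`-subalgebra of `End_L(V)` generated by `A` and `RL` the `L`-span of `R`. Then:
(a) the Jacobson radical of `AL` equals `RL`; (b) `RL ∩ A = R`; (c) the canonical map
`(A/R) ⊗[K] L → AL/RL` is bijective; here (c) is expressed by saying that for any
realization `q : AL → Q` of the quotient `AL/RL`, the induced `K`-linear map
`μ : A ⊗[K] L → Q` is surjective with kernel the image of `R ⊗[K] L`. -/
theorem base_change_of_jacobson_radical
    (K : Type u) [Field K] [Infinite K] [PerfectField K]
    (L : Type u) [Field L] [Algebra K L]
    (V : Type u) [AddCommGroup V] [Module L V] [FiniteDimensional L V]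
    [Module K V] [IsScalarTower K L V]
    (A : Subalgebra K (Module.End L V))
    (hA : ∀ a : A, ∀ i : ℕ,
      (LinearMap.charpoly (A.val a)).coeff i ∈ Set.range (algebraMap K L))
    (AL : Subalgebra L (Module.End L V))
    (hAL : AL = Algebra.adjoin L (A : Set (Module.End L V)))
    (RL : Submodule L (Module.End L V))
    (hRL : RL = Submodule.span L
      (Subtype.val '' {x : A | x ∈ Ideal.jacobson (⊥ : Ideal A)})) :
    (∀ x : AL, x ∈ Ideal.jacobson (⊥ : Ideal AL) ↔ (x : Module.End L V) ∈ RL) ∧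
    (∀ a : A, (a : Module.End L V) ∈ RL ↔ a ∈ Ideal.jacobson (⊥ : Ideal A)) ∧
    (∀ (Q : Type u) [Ring Q] [Algebra L Q] [Algebra K Q] [IsScalarTower K L Q]
      (q : AL →ₐ[L] Q), Function.Surjective q →
      (∀ x : AL, q x = 0 ↔ (x : Module.End L V) ∈ RL) →
      ∀ μ : TensorProduct K A L →ₗ[K] Q,
        (∀ (a : A) (l : L) (ha : (a : Module.End L V) ∈ AL),
          μ (a ⊗ₜ[K] l) = l • q ⟨(a : Module.End L V), ha⟩) →
        Function.Surjective μ ∧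
        ∀ z : TensorProduct K A L, μ z = 0 ↔
          z ∈ LinearMap.range (LinearMap.rTensor L
            (Submodule.subtype (Submodule.restrictScalars K
              (Ideal.jacobson (⊥ : Ideal A)))))) := by
  have hAL' : Subalgebra.toSubmodule AL = Submodule.span L (A : Set (Module.End L V)) := by
    rw [hAL, Algebra.adjoin_eq_span]
    exact congrArg _ (congrArg _ (Submonoid.closure_eq A.toSubmonoid))
  have hmemAL {f : Module.End L V} :
      f ∈ AL ↔ f ∈ Submodule.span L (A : Set (Module.End L V)) := by
    rw [← hAL', Subalgebra.mem_toSubmodule]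
  have hAle {f : Module.End L V} (hf : f ∈ A) : f ∈ AL := hmemAL.2 (Submodule.subset_span hf)
  set v := Module.Basis.ofVectorSpace K L
  set R : Submodule K (Module.End L V) :=
    (Submodule.restrictScalars K (Ideal.jacobson (⊥ : Ideal A))).map A.val.toLinearMap with hR
  have hRL' : RL = Submodule.span L (R : Set (Module.End L V)) := hRL
  have hAint (a : A) : IsIntegral K a := by
    have hp : LinearMap.charpoly (A.val a) ∈ Polynomial.lifts (algebraMap K L) :=
      (Polynomial.lifts_iff_coeff_lifts _).2 (hA a)
    obtain ⟨p, hp, -, hpm⟩ := Polynomial.lifts_and_degree_eq_and_monic hp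
      (LinearMap.charpoly_monic _)
    refine ⟨p, hpm, ?_⟩
    have h0 : Polynomial.aeval (A.val a) p = 0 := by
      rw [← Polynomial.aeval_map_algebraMap L, hp, LinearMap.aeval_self_charpoly]
    rw [← Polynomial.aeval_def]
    refine Subtype.val_injective ?_
    rw [← Subalgebra.coe_val, ← Polynomial.aeval_algHom_apply, h0]
    rfl
  have hRnil : ∀ f ∈ R, IsNilpotent f := by
    rintro _ ⟨a, ha, rfl⟩
    exact ((hAint a).isNilpotent_of_mem_jacobson ha).map A.val
  have hRLnil {f : Module.End L V} (hf : f ∈ RL) : IsNilpotent f :=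
    Module.End.isNilpotent_of_mem_span R hRnil (hRL' ▸ hf)
  have hRLmul {f g : Module.End L V} (hf : f ∈ AL) (hg : g ∈ RL) : f * g ∈ RL := by
    rw [hRL'] at hg ⊢
    have := Submodule.mul_mem_mul (hmemAL.1 hf) hg
    rw [Submodule.span_mul_span] at this
    refine Submodule.span_mono ?_ this
    rintro _ ⟨a, ha, _, ⟨b, hb, rfl⟩, rfl⟩
    exact ⟨⟨a, ha⟩ * b, Ideal.mul_mem_left _ _ hb, rfl⟩
  have hJ {x : AL} (hx : x ∈ Ideal.jacobson (⊥ : Ideal AL)) {w : _ →₀ A}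
      (hw : w.sum (fun i a => v i • (a : Module.End L V)) = x) (i) :
      w i ∈ Ideal.jacobson (⊥ : Ideal A) := by
    refine A.mem_jacobson_of_sum_smul_mem hA v.linearIndependent
      (Subtype.val '' {x : AL | x ∈ Ideal.jacobson (⊥ : Ideal AL)}) ?_ ?_ ⟨x, hx, hw.symm⟩ i
    · rintro a ha _ ⟨y, hy, rfl⟩
      exact ⟨⟨a, hAle ha⟩ * y, (Ideal.jacobson (⊥ : Ideal AL)).mul_mem_left _ hy, rfl⟩
    · rintro _ ⟨y, hy, rfl⟩
      exact ((Algebra.IsIntegral.isIntegral (R := L) y).isNilpotent_of_mem_jacobson hy).map AL.val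
  have hrep (x : AL) : ∃ w : _ →₀ A, w.sum (fun i a => v i • (a : Module.End L V)) = x := by
    obtain ⟨w, hwA, hw⟩ := Submodule.exists_finsupp_of_mem_span v (Subalgebra.toSubmodule A)
      (hmemAL.1 x.2)
    refine ⟨Finsupp.onFinset w.support (fun i => ⟨w i, hwA i⟩) fun i hi => ?_, ?_⟩
    · exact Finsupp.mem_support_iff.2 fun h => hi (Subtype.ext h)
    · rw [← hw, Finsupp.onFinset_sum _ (by simp)]
      rfl
  have ha : ∀ x : AL, x ∈ Ideal.jacobson (⊥ : Ideal AL) ↔ (x : Module.End L V) ∈ RL := by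
    refine fun x => ⟨fun hx => ?_, fun hx => ?_⟩
    · obtain ⟨w, hw⟩ := hrep x
      rw [← hw, hRL']
      exact Submodule.sum_mem _ fun i _ => Submodule.smul_mem _ _
        (Submodule.subset_span ⟨w i, hJ hx hw i, rfl⟩)
    · refine Ideal.mem_jacobson_bot_of_isNilpotent_mul fun y => ?_
      rw [← IsNilpotent.map_iff (f := AL.val) Subtype.val_injective]
      exact hRLnil (hRLmul y.2 hx)
  have hsumAL (w : _ →₀ A) : w.sum (fun i a => v i • (a : Module.End L V)) ∈ AL :=
    AL.sum_mem fun i _ => AL.smul_mem (hAle (w i).2) _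
  refine ⟨ha, fun a => ⟨fun h => ?_, fun h => ?_⟩, fun Q _ _ _ _ q hq hq0 μ hμ => ?_⟩
  · refine Ideal.mem_jacobson_bot_of_isNilpotent_mul fun y => ?_
    rw [← IsNilpotent.map_iff (f := A.val) Subtype.val_injective]
    exact hRLnil (hRLmul (hAle y.2) h)
  · exact hRL' ▸ Submodule.subset_span ⟨a, h, rfl⟩
  have hμw (w : _ →₀ A) : μ (w.sum fun i a => a ⊗ₜ[K] v i) = q ⟨_, hsumAL w⟩ := by
    have h : (⟨_, hsumAL w⟩ : AL) = w.sum fun i a => v i • ⟨(a : Module.End L V), hAle a.2⟩ :=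
      Subtype.ext (by simp [Finsupp.sum])
    rw [h, Finsupp.sum, Finsupp.sum, map_sum, map_sum]
    exact Finset.sum_congr rfl fun i _ => by rw [hμ _ _ (hAle (w i).2), map_smul]
  refine ⟨fun y => ?_, fun z => ⟨fun hz => ?_, ?_⟩⟩
  · obtain ⟨x, rfl⟩ := hq y
    obtain ⟨w, hw⟩ := hrep x
    exact ⟨_, (hμw w).trans (congrArg q (Subtype.ext hw))⟩
  · classical
    obtain ⟨w, rfl⟩ := (TensorProduct.equivFinsuppOfBasisRight v).symm.surjective z
    rw [TensorProduct.equivFinsuppOfBasisRight_symm_apply] at hz ⊢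
    rw [hμw, hq0, ← ha] at hz
    exact Submodule.sum_mem _ fun i _ => ⟨⟨w i, hJ hz rfl i⟩ ⊗ₜ v i, rfl⟩
  · rintro ⟨y, rfl⟩
    induction y with
    | zero => simp
    | add y z hy hz => rw [map_add, map_add, hy, hz, add_zero]
    | tmul r l =>
      have hr : q ⟨_, hAle (r : A).2⟩ = 0 :=
        (hq0 _).2 (hRL' ▸ Submodule.subset_span ⟨(r : A), r.2, rfl⟩)
      rw [LinearMap.rTensor_tmul, Submodule.subtype_apply, hμ _ _ (hAle (r : A).2), hr, smul_zero]
end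

section
/- Let K be a field, A a Wedderburn K-algebra (the Jacobson radical J(A) is nilpotent and A/J(A) is a separable K-algebra), and L any field extension of K. Then: (a) an element a ∈ A satisfies a ⊗ 1 ∈ J(A ⊗[K] L) if and only if a ∈ J(A); (b) the Jacobson radical J(A ⊗[K] L) equals the image of J(A) ⊗[K] L under the canonical map J(A) ⊗[K] L → A ⊗[K] L; (c) A ⊗[K] L is a Wedderburn L-algebra. -/
open TensorProduct

universe u v

attribute [local instance] Algebra.TensorProduct.rightAlgebra

theorem Submodule.pow_eq_bot_of_isNilpotentSet {K A : Type*} [CommRing K] [Ring A] [Algebra K A]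
    {P : Submodule K A} (h : IsNilpotentSet (P : Set A)) : ∃ n : ℕ, 0 < n ∧ P ^ n = ⊥ := by
  obtain ⟨n, hn, h⟩ := h
  refine ⟨n, hn, ?_⟩
  rw [Submodule.pow_eq_span_pow_set, Submodule.span_eq_bot]
  intro x hx
  obtain ⟨f, rfl⟩ := Set.mem_pow.mp hx
  refine h _ (fun y hy => ?_) (by simp)
  obtain ⟨i, rfl⟩ := List.mem_ofFn.mp hy
  exact (f i).2

theorem Submodule.list_prod_mem_pow_length {K A : Type*} [CommSemiring K] [Semiring A]
    [Algebra K A] {P : Submodule K A} (l : List A) (hl : ∀ x ∈ l, x ∈ P) :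
    l.prod ∈ P ^ l.length := by
  induction l with
  | nil => simpa using Submodule.one_le.mp (le_refl (1 : Submodule K A))
  | cons a l ih =>
    rw [List.prod_cons, List.length_cons, pow_succ']
    exact Submodule.mul_mem_mul (hl a (by simp)) (ih fun x hx => hl x (by simp [hx]))

theorem Submodule.isNilpotentSet_of_pow_eq_bot {K A : Type*} [CommRing K] [Ring A] [Algebra K A]
    {P : Submodule K A} {n : ℕ} (hn : 0 < n) (h : P ^ n = ⊥) : IsNilpotentSet (P : Set A) := by
  refine ⟨n, hn, fun l hl hlen => ?_⟩
  have := Submodule.list_prod_mem_pow_length l hl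
  rwa [hlen, h, Submodule.mem_bot] at this

theorem Submodule.range_rTensor_subtype_mul_le {K A L : Type*} [CommRing K] [Ring A] [Algebra K A]
    [CommRing L] [Algebra K L] (P Q : Submodule K A) :
    LinearMap.range (LinearMap.rTensor L P.subtype) *
        LinearMap.range (LinearMap.rTensor L Q.subtype) ≤
      LinearMap.range (LinearMap.rTensor L (P * Q).subtype) := by
  rw [Submodule.mul_le]
  rintro _ ⟨x, rfl⟩ _ ⟨y, rfl⟩
  induction x with
  | zero => simp
  | add x₁ x₂ h₁ h₂ =>
    rw [map_add, add_mul]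
    exact add_mem h₁ h₂
  | tmul p l =>
    induction y with
    | zero => simp
    | add y₁ y₂ h₁ h₂ =>
      rw [map_add, mul_add]
      exact add_mem h₁ h₂
    | tmul q m =>
      exact ⟨(⟨p * q, Submodule.mul_mem_mul p.2 q.2⟩ : ↥(P * Q)) ⊗ₜ (l * m), by simp⟩

theorem Submodule.range_rTensor_subtype_pow_le {K A L : Type*} [CommRing K] [Ring A] [Algebra K A]
    [CommRing L] [Algebra K L] (P : Submodule K A) {n : ℕ} (hn : 0 < n) :
    LinearMap.range (LinearMap.rTensor L P.subtype) ^ n ≤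
      LinearMap.range (LinearMap.rTensor L (P ^ n).subtype) := by
  induction n, hn using Nat.le_induction with
  | base => rw [Nat.succ_eq_add_one, zero_add, pow_one, pow_one]
  | succ n hn ih =>
    rw [pow_succ, pow_succ]
    exact (mul_le_mul_left ih _).trans (Submodule.range_rTensor_subtype_mul_le _ _)

theorem IsNilpotentSet.range_rTensor_subtype {K A : Type*} (L : Type*) [CommRing K] [Ring A]
    [Algebra K A] [CommRing L] [Algebra K L] {P : Submodule K A}
    (h : IsNilpotentSet (P : Set A)) :
    IsNilpotentSet (LinearMap.range (LinearMap.rTensor L P.subtype) : Set (A ⊗[K] L)) := by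
  obtain ⟨n, hn, h⟩ := Submodule.pow_eq_bot_of_isNilpotentSet h
  refine Submodule.isNilpotentSet_of_pow_eq_bot hn (le_bot_iff.mp ?_)
  refine (Submodule.range_rTensor_subtype_pow_le P hn).trans ?_
  rw [h, LinearMap.range_le_iff_comap, eq_top_iff]
  intro x _
  induction x with
  | zero => simp
  | add x y hx hy => exact add_mem (hx trivial) (hy trivial)
  | tmul p l =>
    have : (p : A) = 0 := p.2
    simp [this]

theorem IsNilpotentSet.isNilpotent {R : Type*} [Ring R] {S : Set R} (h : IsNilpotentSet S)
    {x : R} (hx : x ∈ S) : IsNilpotent x := by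
  obtain ⟨n, -, h⟩ := h
  refine ⟨n, ?_⟩
  simpa using h (List.replicate n x) (fun y hy => List.eq_of_mem_replicate hy ▸ hx) (by simp)

theorem Ideal.le_jacobson_bot_of_isNilpotentSet {R : Type*} [Ring R] {I : Ideal R}
    (h : IsNilpotentSet (I : Set R)) : I ≤ Ideal.jacobson ⊥ := by
  intro x hx
  rw [Ideal.mem_jacobson_iff]
  intro y
  obtain ⟨u, hu⟩ := (h.isNilpotent (I.mul_mem_left y hx)).isUnit_add_one
  refine ⟨↑u⁻¹, ?_⟩
  have : (↑u⁻¹ : R) * (y * x + 1) = 1 := by rw [← hu, Units.inv_mul]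
  rw [Submodule.mem_bot, sub_eq_zero, ← this]
  noncomm_ring

theorem RingHom.jacobson_bot_le_ker {R S : Type*} [Ring R] [Ring S] [IsSemisimpleRing S]
    {f : R →+* S} (hf : Function.Surjective f) : Ideal.jacobson ⊥ ≤ RingHom.ker f := by
  have : RingHomSurjective f := ⟨hf⟩
  intro x hx
  rw [Ideal.jacobson_bot] at hx
  simpa [IsSemisimpleRing.jacobson_eq_bot] using Ring.le_comap_jacobson f hx

theorem RingQuot.mkAlgHom_apply (K : Type*) {R : Type*} [CommSemiring K] [Semiring R]
    [Algebra K R] (r : R → R → Prop) (x : R) : RingQuot.mkAlgHom K r x = RingQuot.mkRingHom r x := by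
  rw [← RingQuot.mkAlgHom_coe K]
  rfl

theorem JacQuot.mkAlgHom_eq_zero_iff {K A : Type*} [CommRing K] [Ring A] [Algebra K A] {a : A} :
    RingQuot.mkAlgHom K (jacRel A) a = 0 ↔ a ∈ Ideal.jacobson (⊥ : Ideal A) := by
  refine ⟨fun h => ?_, fun h => ?_⟩
  · rw [Ideal.jacobson_bot]
    let f : JacQuot A →+* A ⧸ Ring.jacobson A :=
      RingQuot.lift ⟨Ideal.Quotient.mk (Ring.jacobson A), fun {x y} hxy => by
        rw [Ideal.Quotient.eq, ← Ideal.jacobson_bot]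
        exact hxy⟩
    have hf : f (RingQuot.mkRingHom _ a) = Ideal.Quotient.mk _ a :=
      RingQuot.lift_mkRingHom_apply _ _ _
    rw [← Ideal.Quotient.eq_zero_iff_mem, ← hf, ← RingQuot.mkAlgHom_apply K, h, map_zero]
  · rw [← map_zero (RingQuot.mkAlgHom K (jacRel A))]
    exact RingQuot.mkAlgHom_rel K (show a - 0 ∈ _ by rwa [sub_zero])

theorem Algebra.TensorProduct.map_id_eq_zero_iff {K A B : Type*} (L : Type*) [CommRing K]
    [Ring A] [Algebra K A] [Ring B] [Algebra K B] [CommRing L] [Algebra K L] {f : A →ₐ[K] B}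
    (hf : Function.Surjective f) {P : Submodule K A} (hP : ∀ a, f a = 0 ↔ a ∈ P)
    (z : A ⊗[K] L) :
    Algebra.TensorProduct.map f (AlgHom.id K L) z = 0 ↔
      z ∈ LinearMap.range (LinearMap.rTensor L P.subtype) := by
  have hex : Function.Exact P.subtype f.toLinearMap := fun a => by
    simpa using hP a
  exact rTensor_exact L hex hf z

theorem IsSeparableKAlgebra.of_span_range_eq_top {K L : Type u} {B C : Type*} [Field K]
    [Field L] [Algebra K L] [Ring B] [Algebra K B] [Ring C] [Algebra L C] [Algebra K C]
    [IsScalarTower K L C] (h : IsSeparableKAlgebra K B) (f : B →ₐ[K] C)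
    (hf : Submodule.span L (Set.range f) = ⊤) : IsSeparableKAlgebra L C := by
  intro M _ _
  let _ : Algebra K M := Algebra.compHom M (algebraMap K L)
  have : IsScalarTower K L M := IsScalarTower.of_algebraMap_eq fun _ => rfl
  have := h M
  let g : M ⊗[K] B →ₐ[M] M ⊗[L] C := Algebra.TensorProduct.lift (Algebra.ofId M _)
    (((Algebra.TensorProduct.includeRight : C →ₐ[L] M ⊗[L] C).restrictScalars K).comp f)
    fun m b => Algebra.commutes m _
  refine RingHom.isSemisimpleRing_of_surjective g.toRingHom ?_
  intro z
  change z ∈ g.range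
  have key (c : C) : (1 : M) ⊗ₜ[L] c ∈ g.range := by
    have hc : c ∈ Submodule.span L (Set.range f) := hf ▸ Submodule.mem_top
    induction hc using Submodule.span_induction with
    | mem c hc =>
      obtain ⟨b, rfl⟩ := hc
      exact ⟨1 ⊗ₜ b, (Algebra.TensorProduct.lift_tmul _ _ _ _ _).trans (by simp)⟩
    | zero => simp
    | add c d _ _ hc hd =>
      rw [TensorProduct.tmul_add]
      exact add_mem hc hd
    | smul l c _ hc =>
      rw [TensorProduct.tmul_smul, ← algebraMap_smul M l]
      exact g.range.smul_mem hc _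
  induction z with
  | zero => exact zero_mem _
  | add x y hx hy => exact add_mem hx hy
  | tmul m c =>
    rw [← mul_one m, ← smul_eq_mul, ← TensorProduct.smul_tmul']
    exact g.range.smul_mem (key c) m

theorem RingQuot.isScalarTower_of_algebra {K L R : Type*} [CommRing K] [CommRing L] [Algebra K L]
    [Ring R] [Algebra K R] [Algebra L R] [IsScalarTower K L R] (r : R → R → Prop) :
    IsScalarTower K L (RingQuot r) :=
  .of_algebraMap_eq fun x => by
    rw [← (RingQuot.mkAlgHom K r).commutes, ← (RingQuot.mkAlgHom L r).commutes,
      ← IsScalarTower.algebraMap_apply, RingQuot.mkAlgHom_apply, RingQuot.mkAlgHom_apply]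

/-- **Base change of Wedderburn algebras.** If `A` is a Wedderburn `K`-algebra and `L/K` a
field extension, then: (a) `a ⊗ 1 ∈ J(A ⊗[K] L)` iff `a ∈ J(A)`; (b) `J(A ⊗[K] L)` is the
image of `J(A) ⊗[K] L`; (c) `A ⊗[K] L` is a Wedderburn `L`-algebra. -/
theorem wedderburn_base_change
    (K : Type u) [Field K] (A : Type u) [Ring A] [Algebra K A]
    (hnil : IsNilpotentSet (Ideal.jacobson (⊥ : Ideal A) : Set A))
    (hsep : IsSeparableKAlgebra K (JacQuot A))
    (L : Type u) [Field L] [Algebra K L] :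
    (∀ a : A, a ⊗ₜ[K] (1 : L) ∈ Ideal.jacobson (⊥ : Ideal (TensorProduct K A L)) ↔
      a ∈ Ideal.jacobson (⊥ : Ideal A)) ∧
    (∀ z : TensorProduct K A L,
      z ∈ Ideal.jacobson (⊥ : Ideal (TensorProduct K A L)) ↔
      z ∈ LinearMap.range (LinearMap.rTensor L (Submodule.subtype
        (Submodule.restrictScalars K (Ideal.jacobson (⊥ : Ideal A)))))) ∧
    (IsNilpotentSet
        (Ideal.jacobson (⊥ : Ideal (TensorProduct K A L)) : Set (TensorProduct K A L)) ∧
      IsSeparableKAlgebra L (JacQuot (TensorProduct K A L))) := by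
  have hss : IsSemisimpleRing (JacQuot A ⊗[K] L) :=
    have := hsep L
    (Algebra.TensorProduct.comm K L (JacQuot A)).toRingEquiv.isSemisimpleRing
  have hsurj : Function.Surjective
      (Algebra.TensorProduct.map (RingQuot.mkAlgHom K (jacRel A)) (AlgHom.id K L)) :=
    TensorProduct.map_surjective (RingQuot.mkAlgHom_surjective K _) Function.surjective_id
  have hker (z : A ⊗[K] L) := Algebra.TensorProduct.map_id_eq_zero_iff L
    (RingQuot.mkAlgHom_surjective K (jacRel A))
    (P := (Ideal.jacobson (⊥ : Ideal A)).restrictScalars K)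
    (fun a => JacQuot.mkAlgHom_eq_zero_iff) z
  have hrange := IsNilpotentSet.range_rTensor_subtype L
    (P := (Ideal.jacobson (⊥ : Ideal A)).restrictScalars K) hnil
  have hb (z : A ⊗[K] L) : z ∈ Ideal.jacobson (⊥ : Ideal (A ⊗[K] L)) ↔
      z ∈ LinearMap.range (LinearMap.rTensor L (Submodule.subtype
        (Submodule.restrictScalars K (Ideal.jacobson (⊥ : Ideal A))))) := by
    rw [← hker]
    refine ⟨fun h => RingHom.jacobson_bot_le_ker
      (f := (Algebra.TensorProduct.map _ _ : A ⊗[K] L →ₐ[K] JacQuot A ⊗[K] L).toRingHom) hsurj h,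
      fun h => Ideal.le_jacobson_bot_of_isNilpotentSet (I := RingHom.ker
        (Algebra.TensorProduct.map (RingQuot.mkAlgHom K (jacRel A)) (AlgHom.id K L))) ?_ h⟩
    convert hrange using 1
    ext z
    exact hker z
  have ha (a : A) : a ⊗ₜ[K] (1 : L) ∈ Ideal.jacobson (⊥ : Ideal (A ⊗[K] L)) ↔
      a ∈ Ideal.jacobson (⊥ : Ideal A) := by
    rw [hb, ← hker, ← JacQuot.mkAlgHom_eq_zero_iff (K := K), Algebra.TensorProduct.map_tmul,
      map_one]
    exact map_eq_zero_iff (Algebra.TensorProduct.includeLeft : JacQuot A →ₐ[K] JacQuot A ⊗[K] L)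
      (Algebra.TensorProduct.includeLeft_injective (FaithfulSMul.algebraMap_injective K L))
  refine ⟨ha, hb, ?_, ?_⟩
  · convert hrange using 1
    ext z
    exact hb z
  · have : IsScalarTower K L (JacQuot (A ⊗[K] L)) := RingQuot.isScalarTower_of_algebra _
    let f : JacQuot A →ₐ[K] JacQuot (A ⊗[K] L) := RingQuot.liftAlgHom K
      ⟨(RingQuot.mkAlgHom K (jacRel (A ⊗[K] L))).comp Algebra.TensorProduct.includeLeft,
        fun {x y} hxy => RingQuot.mkAlgHom_rel K <| by
          change x ⊗ₜ 1 - y ⊗ₜ 1 ∈ _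
          rw [← TensorProduct.sub_tmul, ha]
          exact hxy⟩
    have hf (a : A) : f (RingQuot.mkAlgHom K _ a) = RingQuot.mkAlgHom L _ (a ⊗ₜ[K] (1 : L)) := by
      refine (RingQuot.liftAlgHom_mkAlgHom_apply _ _ _ _).trans ?_
      rw [AlgHom.comp_apply, RingQuot.mkAlgHom_apply, RingQuot.mkAlgHom_apply]
      rfl
    refine hsep.of_span_range_eq_top f (eq_top_iff.mpr fun c _ => ?_)
    obtain ⟨z, rfl⟩ := RingQuot.mkAlgHom_surjective L _ c
    induction z with
    | zero => simp
    | add x y hx hy =>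
      rw [map_add]
      exact add_mem (hx trivial) (hy trivial)
    | tmul a l =>
      have : a ⊗ₜ[K] l = l • a ⊗ₜ[K] (1 : L) := by
        rw [Algebra.smul_def, Algebra.TensorProduct.right_algebraMap_apply]
        simp
      rw [this, map_smul, ← hf]
      exact Submodule.smul_mem _ _ (Submodule.subset_span ⟨_, rfl⟩)
end

section
/- Let K be a field and A a (unital associative) K-algebra. Suppose that for every field extension L of K the L-algebra A ⊗[K] L is semiprimary (its Jacobson radical is nilpotent and the quotient by its Jacobson radical is a semisimple ring) and that the Jacobson radical J(A ⊗[K] L) is contained in the image of J(A) ⊗[K] L under the canonical map J(A) ⊗[K] L → A ⊗[K] L. Then A is a Wedderburn K-algebra, i.e. J(A) is nilpotent and A/J(A) is a separable K-algebra. -/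
open TensorProduct

universe u v

/-- Nilpotency of the Jacobson radical is reflected by ring isomorphisms. -/
theorem IsNilpotentSet.jacobson_of_ringEquiv {R S : Type*} [Ring R] [Ring S] (e : R ≃+* S)
    (h : IsNilpotentSet (Ideal.jacobson (⊥ : Ideal S) : Set S)) :
    IsNilpotentSet (Ideal.jacobson (⊥ : Ideal R) : Set R) := by
  obtain ⟨n, hn, h⟩ := h
  refine ⟨n, hn, fun l hl hlen => e.injective ?_⟩
  rw [map_zero, map_list_prod]
  refine h _ (fun y hy => ?_) (by simpa using hlen)
  obtain ⟨x, hx, rfl⟩ := List.mem_map.mp hy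
  have hxJ := hl x hx
  rw [SetLike.mem_coe, Ideal.mem_jacobson_iff] at hxJ ⊢
  intro t
  obtain ⟨z, hz⟩ := hxJ (e.symm t)
  refine ⟨e z, ?_⟩
  rw [Ideal.mem_bot] at hz ⊢
  simpa using congrArg e hz

/-- The canonical algebra map from `A ⊗[K] L` to `L ⊗[K] JacQuot A`. -/
noncomputable def tensorToJacQuot (K A L : Type*) [Field K] [Ring A] [Algebra K A]
    [Field L] [Algebra K L] : A ⊗[K] L →ₐ[K] L ⊗[K] JacQuot A :=
  (Algebra.TensorProduct.comm K (JacQuot A) L).toAlgHom.comp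
    (Algebra.TensorProduct.map (RingQuot.mkAlgHom K (jacRel A)) (AlgHom.id K L))

theorem tensorToJacQuot_tmul {K A L : Type*} [Field K] [Ring A] [Algebra K A]
    [Field L] [Algebra K L] (a : A) (x : L) :
    tensorToJacQuot K A L (a ⊗ₜ x) = x ⊗ₜ RingQuot.mkAlgHom K (jacRel A) a := rfl

theorem tensorToJacQuot_surjective (K A L : Type*) [Field K] [Ring A] [Algebra K A]
    [Field L] [Algebra K L] : Function.Surjective (tensorToJacQuot K A L) :=
  (Algebra.TensorProduct.comm K (JacQuot A) L).surjective.comp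
    (TensorProduct.map_surjective (RingQuot.mkAlgHom_surjective K (jacRel A))
      Function.surjective_id)

theorem tensorToJacQuot_eq_zero {K A L : Type*} [Field K] [Ring A] [Algebra K A]
    [Field L] [Algebra K L] {z : A ⊗[K] L}
    (hz : z ∈ LinearMap.range (LinearMap.rTensor L (Submodule.subtype
      (Submodule.restrictScalars K (Ideal.jacobson (⊥ : Ideal A)))))) :
    tensorToJacQuot K A L z = 0 := by
  obtain ⟨w, rfl⟩ := hz
  induction w with
  | zero => simp
  | add x y hx hy => rw [map_add, map_add, hx, hy, add_zero]
  | tmul a x =>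
    have hrel : jacRel A a 0 := by
      rw [jacRel, sub_zero]
      exact a.2
    rw [LinearMap.rTensor_tmul, Submodule.subtype_apply, tensorToJacQuot_tmul,
      RingQuot.mkAlgHom_rel K hrel, map_zero, TensorProduct.tmul_zero]

/-- A surjective ring homomorphism killing the Jacobson radical has semisimple target as soon as
the quotient of its source by the Jacobson radical is semisimple. -/
theorem IsSemisimpleRing.of_jacQuot {R S : Type*} [Ring R] [Ring S] [IsSemisimpleRing (JacQuot R)]
    (f : R →+* S) (hf : Function.Surjective f)
    (hJ : ∀ z ∈ Ideal.jacobson (⊥ : Ideal R), f z = 0) : IsSemisimpleRing S := by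
  have hrel : ∀ ⦃x y : R⦄, jacRel R x y → f x = f y := fun x y hxy =>
    sub_eq_zero.mp (by rw [← map_sub, hJ _ hxy])
  refine RingHom.isSemisimpleRing_of_surjective (RingQuot.lift ⟨f, hrel⟩) fun y => ?_
  obtain ⟨x, rfl⟩ := hf y
  exact ⟨RingQuot.mkRingHom _ x, RingQuot.lift_mkRingHom_apply f hrel x⟩

/-- If `A ⊗[K] L` is semiprimary for every field extension `L/K` (its Jacobson radical is
nilpotent and the quotient by it is semisimple) and `J(A ⊗[K] L)` is always contained in
the image of `J(A) ⊗[K] L`, then `A` is a Wedderburn `K`-algebra. -/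
theorem wedderburn_of_base_change_semiprimary
    (K : Type u) [Field K] (A : Type u) [Ring A] [Algebra K A]
    (h : ∀ (L : Type u) [Field L] [Algebra K L],
      IsNilpotentSet
        (Ideal.jacobson (⊥ : Ideal (TensorProduct K A L)) : Set (TensorProduct K A L)) ∧
      IsSemisimpleRing (JacQuot (TensorProduct K A L)) ∧
      ∀ z : TensorProduct K A L,
        z ∈ Ideal.jacobson (⊥ : Ideal (TensorProduct K A L)) →
        z ∈ LinearMap.range (LinearMap.rTensor L (Submodule.subtype
          (Submodule.restrictScalars K (Ideal.jacobson (⊥ : Ideal A)))))) :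
    IsNilpotentSet (Ideal.jacobson (⊥ : Ideal A) : Set A) ∧
    IsSeparableKAlgebra K (JacQuot A) := by
  refine ⟨.jacobson_of_ringEquiv (Algebra.TensorProduct.rid K K A).symm.toRingEquiv (h K).1, ?_⟩
  intro L _ _
  obtain ⟨-, _, hJ⟩ := h L
  exact .of_jacQuot (tensorToJacQuot K A L).toRingHom (tensorToJacQuot_surjective K A L)
    fun z hz => tensorToJacQuot_eq_zero (hJ z hz)
end

section
/- (Nagata–Higman) Let n ≥ 1 be an integer and let K be a commutative ring in which n! is invertible. Let R be a (possibly non-unital) associative K-algebra such that xⁿ = 0 for every x ∈ R. Then R^{2ⁿ−1} = 0, i.e. every product of 2ⁿ − 1 elements of R is zero. -/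
universe u v

/-- `npowNU x n` is the `n`-fold product `x * x * ⋯ * x` for `n ≥ 1` (and `x` for
`n = 0`), in a possibly non-unital ring. -/
def npowNU {R : Type*} [Mul R] (x : R) : ℕ → R
  | 0 => x
  | 1 => x
  | n + 2 => npowNU x (n + 1) * x

/-- The left-associated product `x * l₀ * l₁ * ⋯` of a nonempty list of elements of a
possibly non-unital ring. -/
def listMulProd {R : Type*} [Mul R] : R → List R → R
  | x, [] => x
  | x, y :: l => listMulProd (x * y) l

open Polynomial in
/-- The linear coefficient of `(x + y X) ^ n` over a possibly noncommutative ring. -/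
theorem coeff_one_C_add_C_mul_X_pow {A : Type*} [Ring A] (x y : A) (n : ℕ) :
    ((C x + C y * X : A[X]) ^ (n + 1)).coeff 1 =
      ∑ i ∈ Finset.range (n + 1), x ^ i * y * x ^ (n - i) := by
  induction n with
  | zero => simp
  | succ n ih =>
    have h0 : ((C x + C y * X : A[X]) ^ (n + 1)).coeff 0 = x ^ (n + 1) := by
      rw [← constantCoeff_apply, map_pow]
      simp
    rw [pow_succ, mul_coeff_one, ih, h0, Finset.sum_range_succ _ (n + 1), Finset.sum_mul]
    simp only [coeff_add, coeff_C_zero, coeff_C_mul, coeff_X_one, coeff_X_zero, mul_one, mul_zero,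
      add_zero, Nat.sub_self, pow_zero, coeff_C_succ, zero_add]
    rw [add_comm]
    congr 1
    refine Finset.sum_congr rfl fun i hi ↦ ?_
    rw [Nat.sub_add_comm (Nat.lt_succ_iff.mp (Finset.mem_range.mp hi)), pow_succ, mul_assoc _ _ x]

theorem Ideal.mem_of_natCast_mul_mem (K : Type*) {A : Type*} [CommRing K] [Ring A] [Algebra K A]
    {I : Ideal A} {k : ℕ} (hk : IsUnit (k : K)) {a : A} (ha : (k : A) * a ∈ I) : a ∈ I := by
  obtain ⟨u, hu⟩ := hk
  have := I.mul_mem_left (algebraMap K A (↑u⁻¹ : K)) ha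
  rwa [← mul_assoc, ← map_natCast (algebraMap K A), ← map_mul, ← hu, Units.inv_mul, map_one,
    one_mul] at this

theorem isUnit_superFactorial {K : Type*} [CommRing K] {n : ℕ} (h : IsUnit (n.factorial : K)) :
    IsUnit (n.superFactorial : K) := by
  induction n with
  | zero => simp
  | succ n ih =>
    rw [Nat.superFactorial_succ, Nat.cast_mul]
    refine h.mul (ih ?_)
    rw [Nat.factorial_succ, Nat.cast_mul] at h
    exact isUnit_of_mul_isUnit_right h

/-- If a polynomial expression with coefficients `c` takes values in a left ideal at `0, …, n`,
and `n!` is invertible, then its coefficients belong to the ideal. -/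
theorem Ideal.mem_of_forall_sum_natCast_pow_mul_mem (K : Type*) {A : Type*} [CommRing K] [Ring A]
    [Algebra K A] {n : ℕ} (hfac : IsUnit (n.factorial : K)) {I : Ideal A} (c : Fin (n + 1) → A)
    (h : ∀ t : Fin (n + 1), ∑ k : Fin (n + 1), (((t : ℕ) : ℤ) ^ (k : ℕ)) • c k ∈ I) (k : Fin (n + 1)) :
    c k ∈ I := by
  refine Ideal.mem_of_natCast_mul_mem K (isUnit_superFactorial hfac) ?_
  let V : Matrix (Fin (n + 1)) (Fin (n + 1)) ℤ := Matrix.vandermonde fun i ↦ ((i : ℕ) : ℤ)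
  have hdet : V.det = n.superFactorial := Matrix.det_vandermonde_id_eq_superFactorial n
  have key : ∑ t, V.adjugate k t • ∑ j, V t j • c j = (n.superFactorial : A) * c k := by
    simp only [Finset.smul_sum, smul_smul]
    rw [Finset.sum_comm]
    simp only [← Finset.sum_smul, ← Matrix.mul_apply, Matrix.adjugate_mul, hdet,
      Matrix.smul_apply, Matrix.one_apply, smul_eq_mul, mul_ite, mul_one, mul_zero, ite_smul,
      zero_smul, Finset.sum_ite_eq, Finset.mem_univ, if_true]
    simp
  rw [← key]
  exact I.sum_mem fun t _ ↦ zsmul_mem (h t) _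

open Polynomial in
/-- Linearization of the identity `x ^ (n + 1) = 0` modulo an ideal. -/
theorem sum_pow_mul_mul_pow_mem (K : Type*) {A : Type*} [CommRing K] [Ring A] [Algebra K A]
    {n : ℕ} (hfac : IsUnit ((n + 1).factorial : K)) {N I : Ideal A}
    (h : ∀ x ∈ N, x ^ (n + 1) ∈ I) {x y : A} (hx : x ∈ N) (hy : y ∈ N) :
    ∑ i ∈ Finset.range (n + 1), x ^ i * y * x ^ (n - i) ∈ I := by
  set p : A[X] := (C x + C y * X) ^ (n + 1) with hp
  rw [← coeff_one_C_add_C_mul_X_pow]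
  refine Ideal.mem_of_forall_sum_natCast_pow_mul_mem K hfac (fun k ↦ p.coeff k) (fun t ↦ ?_) 1
  have hdeg : p.natDegree < n + 1 + 1 := by
    refine Nat.lt_succ_of_le ((natDegree_pow_le_of_le (n + 1) (m := 1) ?_).trans (by simp))
    compute_degree
  have hev : p.eval ((t : ℕ) : A) = (x + y * (t : ℕ)) ^ (n + 1) := by
    change eval₂RingHom' (RingHom.id A) ((t : ℕ) : A) (fun a ↦ Nat.commute_cast a _) p = _
    rw [hp, map_pow]
    congr 1
    change eval ((t : ℕ) : A) (C x + C y * X) = _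
    simp
  have hsum : ∑ k : Fin (n + 1 + 1), (((t : ℕ) : ℤ) ^ (k : ℕ)) • p.coeff k =
      (x + y * (t : ℕ)) ^ (n + 1) := by
    rw [← hev, eval_eq_sum_range' hdeg, Finset.sum_range]
    refine Finset.sum_congr rfl fun k _ ↦ ?_
    rw [zsmul_eq_mul]
    push_cast
    exact ((Nat.cast_commute _ _).pow_left _)
  rw [hsum]
  refine h _ (N.add_mem hx ?_)
  rw [← Nat.cast_comm]
  exact N.mul_mem_left _ hy

/-- If `x ^ (n + 1) ∈ I` for all `x` in `N`, then `x ^ n * z * y ^ n ∈ I` for all `x, y, z`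
in `N`. -/
theorem pow_mul_mul_pow_mem (K : Type*) {A : Type*} [CommRing K] [Ring A] [Algebra K A]
    {n : ℕ} (hfac : IsUnit ((n + 1).factorial : K)) {N I : Ideal A} [N.IsTwoSided] [I.IsTwoSided]
    (h : ∀ x ∈ N, x ^ (n + 1) ∈ I) {x y z : A} (hx : x ∈ N) (hy : y ∈ N) (hz : z ∈ N) :
    x ^ n * z * y ^ n ∈ I := by
  have hn : IsUnit ((n + 1 : ℕ) : K) := by
    rw [Nat.factorial_succ, Nat.cast_mul] at hfac
    exact isUnit_of_mul_isUnit_left hfac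
  refine Ideal.mem_of_natCast_mul_mem K hn ?_
  have hS : ∑ i ∈ Finset.range (n + 1), ∑ j ∈ Finset.range (n + 1),
      x ^ i * (z * y ^ j) * x ^ (n - i) * y ^ (n - j) ∈ I := by
    rw [Finset.sum_comm]
    refine I.sum_mem fun j _ ↦ ?_
    rw [← Finset.sum_mul]
    exact I.mul_mem_right _ (sum_pow_mul_mul_pow_mem K hfac h hx (N.mul_mem_right _ hz))
  rw [Finset.sum_range_succ] at hS
  have hlt : ∑ i ∈ Finset.range n, ∑ j ∈ Finset.range (n + 1),
      x ^ i * (z * y ^ j) * x ^ (n - i) * y ^ (n - j) ∈ I := by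
    refine I.sum_mem fun i hi ↦ ?_
    have hxi : x ^ (n - i) ∈ N :=
      N.pow_mem_of_mem hx _ (Nat.sub_pos_of_lt (Finset.mem_range.mp hi))
    have := I.mul_mem_left (x ^ i * z) (sum_pow_mul_mul_pow_mem K hfac h hy hxi)
    rw [Finset.mul_sum] at this
    simpa only [mul_assoc] using this
  convert (I.add_mem_iff_right hlt).mp hS using 1
  have hconst : ∀ j ∈ Finset.range (n + 1),
      x ^ n * (z * y ^ j) * x ^ (n - n) * y ^ (n - j) = x ^ n * z * y ^ n := fun j hj ↦ by
    have hj' : j + (n - j) = n := by have := Finset.mem_range.mp hj; omega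
    simp [mul_assoc, ← pow_add, hj']
  rw [Finset.sum_congr rfl hconst, Finset.sum_const, Finset.card_range, nsmul_eq_mul]

/-- Nagata–Higman for an ideal `N` of a unital algebra, modulo another ideal `I`. -/
theorem prod_mem_of_forall_pow_mem (K : Type*) {A : Type*} [CommRing K] [Ring A] [Algebra K A]
    {n : ℕ} (hfac : IsUnit (n.factorial : K)) {N I : Ideal A} [N.IsTwoSided] [I.IsTwoSided]
    (h : ∀ x ∈ N, x ^ n ∈ I) (l : List A) (hl : ∀ a ∈ l, a ∈ N) (hlen : l.length = 2 ^ n - 1) :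
    l.prod ∈ I := by
  induction n generalizing I l with
  | zero =>
    have h1 : (1 : A) ∈ I := by simpa using h 0 N.zero_mem
    simpa using I.mul_mem_left l.prod h1
  | succ n ih =>
    have hfac' : IsUnit (n.factorial : K) := by
      rw [Nat.factorial_succ, Nat.cast_mul] at hfac
      exact isUnit_of_mul_isUnit_right hfac
    let J : Ideal A :=
      { carrier := {u | ∀ z ∈ N, ∀ y ∈ N, u * z * y ^ n ∈ I}
        add_mem' := fun ha hb z hz y hy ↦ by
          simpa only [add_mul] using I.add_mem (ha z hz y hy) (hb z hz y hy)
        zero_mem' := fun z _ y _ ↦ by simp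
        smul_mem' := fun c u hu z hz y hy ↦ by
          simpa only [smul_eq_mul, mul_assoc] using I.mul_mem_left c (hu z hz y hy) }
    have hJ : J.IsTwoSided := ⟨fun {u} b hu z hz y hy ↦ by
      simpa only [mul_assoc] using hu (b * z) (N.mul_mem_left b hz) y hy⟩
    let L : Ideal A :=
      { carrier := {v | ∀ u ∈ J, ∀ z ∈ N, u * z * v ∈ I}
        add_mem' := fun ha hb u hu z hz ↦ by
          simpa only [mul_add] using I.add_mem (ha u hu z hz) (hb u hu z hz)
        zero_mem' := fun u _ z _ ↦ by simp
        smul_mem' := fun c v hv u hu z hz ↦ by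
          simpa only [smul_eq_mul, mul_assoc] using hv u hu (z * c) (N.mul_mem_right c hz) }
    have hL : L.IsTwoSided := ⟨fun {v} b hv u hu z hz ↦ by
      simpa only [mul_assoc] using I.mul_mem_right b (hv u hu z hz)⟩
    have hJpow : ∀ x ∈ N, x ^ n ∈ J := fun x hx z hz y hy ↦
      pow_mul_mul_pow_mem K hfac h hx hy hz
    have hLpow : ∀ x ∈ N, x ^ n ∈ L := fun x hx u hu z hz ↦ hu z hz x hx
    have hpos : 1 ≤ 2 ^ n := Nat.one_le_two_pow
    rw [pow_succ] at hlen
    have hJmem := ih (I := J) hfac' hJpow (l.take (2 ^ n - 1))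
      (fun a ha ↦ hl a (List.mem_of_mem_take ha)) (by rw [List.length_take]; omega)
    have hlt : 2 ^ n - 1 < l.length := by omega
    have hLmem := ih (I := L) hfac' hLpow (l.drop (2 ^ n - 1 + 1))
      (fun a ha ↦ hl a (List.mem_of_mem_drop ha)) (by rw [List.length_drop]; omega)
    rw [← List.prod_take_mul_prod_drop l (2 ^ n - 1), List.drop_eq_getElem_cons hlt,
      List.prod_cons, ← mul_assoc]
    exact hLmem _ hJmem _ (hl _ (List.getElem_mem hlt))

theorem Unitization.inr_npowNU (K : Type*) {R : Type*} [CommRing K] [NonUnitalRing R] [Module K R]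
    [SMulCommClass K R R] [IsScalarTower K R R] (x : R) (n : ℕ) :
    (Unitization.inr (npowNU x (n + 1)) : Unitization K R) = Unitization.inr x ^ (n + 1) := by
  induction n with
  | zero => simp [npowNU]
  | succ n ih => rw [npowNU, Unitization.inr_mul, ih, pow_succ _ (n + 1)]

theorem Unitization.inr_listMulProd (K : Type*) {R : Type*} [CommRing K] [NonUnitalRing R]
    [Module K R] [SMulCommClass K R R] [IsScalarTower K R R] (x : R) (l : List R) :
    (Unitization.inr (listMulProd x l) : Unitization K R) =
      ((x :: l).map Unitization.inr).prod := by
  induction l generalizing x with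
  | nil => simp [listMulProd]
  | cons y l ih => simp [listMulProd, ih, mul_assoc]

/-- **Nagata–Higman theorem.** Let `n ≥ 1` and let `K` be a commutative ring in which `n!`
is invertible. If `R` is a (possibly non-unital) associative `K`-algebra in which
`x ^ n = 0` for every `x`, then every product of `2 ^ n - 1` elements of `R` is zero. -/
theorem nagata_higman
    (K : Type u) [CommRing K] (n : ℕ) (hn : 1 ≤ n) (hfac : IsUnit (n.factorial : K))
    (R : Type v) [NonUnitalRing R] [Module K R] [SMulCommClass K R R] [IsScalarTower K R R]
    (hnil : ∀ x : R, npowNU x n = 0) :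
    ∀ (x : R) (l : List R), (x :: l).length = 2 ^ n - 1 → listMulProd x l = 0 := by
  intro x l hlen
  let N : Ideal (Unitization K R) := RingHom.ker (Unitization.fstHom K R)
  have hN : ∀ r : R, (Unitization.inr r : Unitization K R) ∈ N := fun r ↦ by
    simp [N, RingHom.mem_ker]
  have hpow : ∀ a ∈ N, a ^ n ∈ (⊥ : Ideal (Unitization K R)) := fun a ha ↦ by
    have ha' : a = Unitization.inr a.snd := Unitization.ext ha rfl
    obtain ⟨m, rfl⟩ := Nat.exists_eq_add_of_le' hn
    rw [ha', ← Unitization.inr_npowNU, hnil, Unitization.inr_zero]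
    exact Ideal.zero_mem _
  have key := prod_mem_of_forall_pow_mem K hfac hpow ((x :: l).map Unitization.inr)
    (fun a ha ↦ by
      obtain ⟨r, _, rfl⟩ := List.mem_map.mp ha
      exact hN r)
    (by rw [List.length_map, hlen])
  rw [← Unitization.inr_listMulProd, Ideal.mem_bot] at key
  exact Unitization.inr_injective (key.trans (Unitization.inr_zero K).symm)
end

section
/- Let K be a field and let A be a unital associative K-algebra. Suppose the multiplication map μ : A ⊗[K] A → A admits a K-linear section s : A → A ⊗[K] A (μ ∘ s = id) which is a homomorphism of A-bimodules, i.e. s(a·x) = (a ⊗ 1)·s(x) and s(x·a) = s(x)·(1 ⊗ a) for all a, x ∈ A, where A ⊗[K] A carries the A-bimodule structure a·(x⊗y)·b = (a x)⊗(y b). Then A is finite-dimensional over K. -/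
open TensorProduct

universe u

/-- If the multiplication map `μ : A ⊗[K] A → A` of a unital associative `K`-algebra `A`
admits a `K`-linear section `s` which is a homomorphism of `A`-bimodules, then `A` is
finite-dimensional over `K`. -/
theorem finiteDimensional_of_bimodule_section_of_mul
    (K : Type u) [Field K] (A : Type u) [Ring A] [Algebra K A]
    (s : A →ₗ[K] TensorProduct K A A)
    (hsec : ∀ x : A, LinearMap.mul' K A (s x) = x)
    (hleft : ∀ a x : A, s (a * x) = a ⊗ₜ[K] (1 : A) * s x)
    (hright : ∀ a x : A, s (x * a) = s x * (1 : A) ⊗ₜ[K] a) :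
    FiniteDimensional K A := by
  let b := Module.Basis.ofVectorSpace K A
  obtain ⟨x, hx⟩ := TensorProduct.eq_repr_basis_right b (s 1)
  let X := Submodule.span K (x '' x.support)
  have : FiniteDimensional K X :=
    FiniteDimensional.span_of_finite K (x.support.finite_toSet.image x)
  have hs (a : A) : s a = ∑ i ∈ x.support, (a * x i) ⊗ₜ[K] b i := by
    simpa [← hx, Finsupp.sum, Finset.mul_sum] using hleft a 1
  have hs' (a : A) : s a = ∑ i ∈ x.support, x i ⊗ₜ[K] (b i * a) := by
    simpa [← hx, Finsupp.sum, Finset.sum_mul] using hright a 1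
  -- Contracting the two formulas for `s a` with the coordinate `b.coord j` shows that `X` is
  -- stable under left multiplication.
  have hmem (a : A) (j : x.support) : a * x j ∈ X := by
    have h := congrArg (fun t ↦ TensorProduct.rid K A ((b.coord j).lTensor A t))
      ((hs a).symm.trans (hs' a))
    have h' : a * x j = ∑ i ∈ x.support, b.repr (b i * a) j • x i := by
      classical
      simpa [Finsupp.single_apply, ite_smul] using h
    rw [h']
    exact X.sum_mem fun i hi ↦ X.smul_mem _ (Submodule.subset_span ⟨i, hi, rfl⟩)
  let f : A →ₗ[K] (x.support → X) :=
    LinearMap.pi fun j ↦ (LinearMap.mulRight K (x j)).codRestrict X (hmem · j)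
  refine FiniteDimensional.of_injective f ((injective_iff_map_eq_zero f).2 fun a ha ↦ ?_)
  rw [← hsec a, hs a, Finset.sum_eq_zero, map_zero]
  intro i hi
  have h : a * x i = 0 := congrArg Subtype.val (congrFun ha ⟨i, hi⟩)
  rw [h, TensorProduct.zero_tmul]
end
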